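/- Let X be a smooth irreducible projective surface over an algebraically closed field of characteristic 0, let φ : X → ℙ^N (N ≥ 4) be an uncrumpled map with image Y = φ(X), let y = φ(x) be the image of a general point x ∈ X, let β_y : Ỹ → Y be the blow-up of Y at y, and let π̃_y : Ỹ → ℙ^{N−1} be the resolution of the inner projection from y. Then π̃_y : Ỹ → ℙ^{N−1} is birational onto its image π̃_y(Ỹ); in particular π̃_y(Ỹ) is a surface. -/

import Mathlib

/-!
Common framework: classical projective varieties over an algebraically closed
field, formalized via `Projectivization`.
-/

open MvPolynomial Module Set Filter

namespace PinchPaper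

variable (k : Type) [Field k]

/-- The classical points of projective `N`-space over `k`. -/
abbrev Pr (N : ℕ) := Projectivization k (Fin (N + 1) → k)

variable {k}

/-- A (homogeneous) polynomial vanishes at a point of projective space. -/
def Vanishes {N : ℕ} (f : MvPolynomial (Fin (N + 1)) k) (p : Pr k N) : Prop :=
  ∀ (v : Fin (N + 1) → k) (hv : v ≠ 0), Projectivization.mk k v hv = p → eval v f = 0

/-- Zariski-closed (projective algebraic) subsets of projective space: common zero
loci of families of homogeneous polynomials. -/
def IsAlgSet {N : ℕ} (Z : Set (Pr k N)) : Prop :=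
  ∃ S : Set (MvPolynomial (Fin (N + 1)) k),
    (∀ f ∈ S, ∃ d, f.IsHomogeneous d) ∧ Z = {p | ∀ f ∈ S, Vanishes f p}

/-- A projective variety: a nonempty algebraic set which is irreducible. -/
def IsVariety {N : ℕ} (Z : Set (Pr k N)) : Prop :=
  IsAlgSet Z ∧ Z.Nonempty ∧
    ∀ Z₁ Z₂ : Set (Pr k N), IsAlgSet Z₁ → IsAlgSet Z₂ → Z ⊆ Z₁ ∪ Z₂ → Z ⊆ Z₁ ∨ Z ⊆ Z₂

/-- `Z` has dimension `n`, via lengths of chains of subvarieties. -/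
def HasDim {N : ℕ} (Z : Set (Pr k N)) (n : ℕ) : Prop :=
  Order.krullDim {W : Set (Pr k N) // IsVariety W ∧ W ⊆ Z} = (n : ℕ∞)

/-- The polynomials vanishing identically on `Z` (as a `k`-submodule). -/
noncomputable def vanishingIdeal {N : ℕ} (Z : Set (Pr k N)) :
    Submodule k (MvPolynomial (Fin (N + 1)) k) :=
  ⨅ p ∈ Z, LinearMap.ker (MvPolynomial.aeval (R := k) (Projectivization.rep p)).toLinearMap

/-- The Hilbert function of the homogeneous coordinate ring of `Z`. -/
noncomputable def hilb {N : ℕ} (Z : Set (Pr k N)) (m : ℕ) : ℕ :=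
  finrank k (↥(homogeneousSubmodule (Fin (N + 1)) k m) ⧸
    (Submodule.comap (homogeneousSubmodule (Fin (N + 1)) k m).subtype (vanishingIdeal Z)))

/-- `Z` (of dimension `n`) has degree `d`: the Hilbert polynomial of `Z` has degree `n`
and leading coefficient `d / n!`. -/
def HasDegree {N : ℕ} (Z : Set (Pr k N)) (n d : ℕ) : Prop :=
  ∃ P : Polynomial ℚ, P.degree = (n : ℕ) ∧ P.leadingCoeff * (n.factorial : ℚ) = (d : ℚ) ∧
    ∀ᶠ m : ℕ in atTop, (hilb Z m : ℚ) = P.eval (m : ℚ)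

/-- A curve `B` has (arithmetic, hence for smooth curves geometric) genus `g`:
its Hilbert polynomial is `P(m) = d·m + (1 - g)`. -/
def HasGenus {N : ℕ} (B : Set (Pr k N)) (g : ℕ) : Prop :=
  ∃ d : ℕ, ∀ᶠ m : ℕ in atTop, (hilb B m : ℤ) = d * m + 1 - g

/-- A line in projective space: the set of points lying in a 2-dimensional linear subspace. -/
def IsLine {N : ℕ} (L : Set (Pr k N)) : Prop :=
  ∃ W : Submodule k (Fin (N + 1) → k), finrank k W = 2 ∧
    L = {p | Projectivization.submodule p ≤ W}

/-- A 2-plane in projective space. -/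
def Is2Plane {N : ℕ} (L : Set (Pr k N)) : Prop :=
  ∃ W : Submodule k (Fin (N + 1) → k), finrank k W = 3 ∧
    L = {p | Projectivization.submodule p ≤ W}

/-- `Y` is non-degenerate: no nonzero linear form vanishes on it. -/
def Nondegenerate {N : ℕ} (Y : Set (Pr k N)) : Prop :=
  ∀ f : MvPolynomial (Fin (N + 1)) k, f.IsHomogeneous 1 → (∀ p ∈ Y, Vanishes f p) → f = 0

/-- `Y` is ruled by lines: it contains infinitely many lines (equivalently, its Fano
scheme of lines is positive-dimensional). -/
def RuledByLines {N : ℕ} (Y : Set (Pr k N)) : Prop :=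
  {L : Set (Pr k N) | IsLine L ∧ L ⊆ Y}.Infinite

/-- The differential of `f` at `v`, as a linear functional. -/
noncomputable def diffAt {N : ℕ} (f : MvPolynomial (Fin (N + 1)) k) (v : Fin (N + 1) → k) :
    (Fin (N + 1) → k) →ₗ[k] k :=
  ∑ j, eval v (pderiv j f) • (LinearMap.proj j : (Fin (N + 1) → k) →ₗ[k] k)

/-- The affine cone over the embedded Zariski tangent space of `Z` at `p`. -/
noncomputable def embTangent {N : ℕ} (Z : Set (Pr k N)) (p : Pr k N) :
    Submodule k (Fin (N + 1) → k) :=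
  ⨅ f ∈ {f : MvPolynomial (Fin (N + 1)) k |
      (∃ d, f.IsHomogeneous d) ∧ ∀ q ∈ Z, Vanishes f q},
    LinearMap.ker (diffAt f (Projectivization.rep p))

/-- A smooth projective surface (embedded in some projective space). -/
def IsSmoothSurface {N : ℕ} (Z : Set (Pr k N)) : Prop :=
  IsVariety Z ∧ HasDim Z 2 ∧ ∀ p ∈ Z, finrank k (embTangent Z p) = 3

/-- A smooth projective curve. -/
def IsSmoothCurve {N : ℕ} (Z : Set (Pr k N)) : Prop :=
  IsVariety Z ∧ HasDim Z 1 ∧ ∀ p ∈ Z, finrank k (embTangent Z p) = 2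

/-- `F` is a local homogeneous representation of `φ` near `p ∈ X`. -/
def LocalRep {M N : ℕ} (X : Set (Pr k M)) (φ : Pr k M → Pr k N) (p : Pr k M)
    (F : Fin (N + 1) → MvPolynomial (Fin (M + 1)) k) : Prop :=
  (∃ d, ∀ i, (F i).IsHomogeneous d) ∧
  (fun i => eval (Projectivization.rep p) (F i)) ≠ 0 ∧
  ∀ q ∈ X, ∀ (v : Fin (M + 1) → k) (hv : v ≠ 0), Projectivization.mk k v hv = q →
    ∀ hFv : (fun i => eval v (F i)) ≠ 0,
      φ q = Projectivization.mk k (fun i => eval v (F i)) hFv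

/-- `φ` is a morphism on the projective set `X`: locally given by homogeneous polynomials. -/
def IsMorphismOn {M N : ℕ} (X : Set (Pr k M)) (φ : Pr k M → Pr k N) : Prop :=
  ∀ p ∈ X, ∃ F, LocalRep X φ p F

/-- The Jacobian of a tuple of polynomials at `v`, as a linear map. -/
noncomputable def jacobian {M N : ℕ} (F : Fin (N + 1) → MvPolynomial (Fin (M + 1)) k)
    (v : Fin (M + 1) → k) : (Fin (M + 1) → k) →ₗ[k] (Fin (N + 1) → k) :=
  Matrix.mulVecLin (Matrix.of fun i j => eval v (pderiv j (F i)))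

/-- `φ` (defined on the surface `X`) is ramified at `p`: its differential has rank ≤ 1,
i.e. the image of the affine tangent cone has rank ≤ 2. -/
def RamifiedAt {M N : ℕ} (X : Set (Pr k M)) (φ : Pr k M → Pr k N) (p : Pr k M) : Prop :=
  ∀ F, LocalRep X φ p F →
    finrank k ((embTangent X p).map (jacobian F (Projectivization.rep p))) ≤ 2

/-- The ramification locus of `φ` on `X`. -/
def RamLocus {M N : ℕ} (X : Set (Pr k M)) (φ : Pr k M → Pr k N) : Set (Pr k M) :=
  {p | p ∈ X ∧ RamifiedAt X φ p}

/-- `φ` is unramified at `p` (injective differential on Zariski tangent spaces). -/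
def UnramifiedAt {M N : ℕ} (X : Set (Pr k M)) (φ : Pr k M → Pr k N) (p : Pr k M) : Prop :=
  ∀ F, LocalRep X φ p F → ∀ w ∈ embTangent X p,
    jacobian F (Projectivization.rep p) w ∈
      Submodule.span k {(fun i => eval (Projectivization.rep p) (F i))} →
    w ∈ Submodule.span k {Projectivization.rep p}

/-- `φ` is a closed embedding on `X`: injective, closed image, unramified, and the
embedded tangent spaces of the image match those of `X`. -/
def IsClosedEmbeddingOn {M N : ℕ} (X : Set (Pr k M)) (φ : Pr k M → Pr k N) : Prop :=
  InjOn φ X ∧ IsAlgSet (φ '' X) ∧ (∀ p ∈ X, UnramifiedAt X φ p) ∧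
    ∀ p ∈ X, finrank k (embTangent (φ '' X) (φ p)) = finrank k (embTangent X p)

/-- `φ` is generically injective on `X` (i.e. birational onto its image). -/
def GenericallyInjectiveOn {M N : ℕ} (X : Set (Pr k M)) (φ : Pr k M → Pr k N) : Prop :=
  ∃ Z : Set (Pr k M), IsAlgSet Z ∧ ¬ X ⊆ Z ∧ InjOn φ (X \ Z)

/-- An uncrumpled map: a morphism with non-degenerate image, birational onto its
image, with finite ramification locus. -/
def Uncrumpled {M N : ℕ} (X : Set (Pr k M)) (φ : Pr k M → Pr k N) : Prop :=
  IsMorphismOn X φ ∧ Nondegenerate (φ '' X) ∧ GenericallyInjectiveOn X φ ∧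
    (RamLocus X φ).Finite

/-- The ramification locus of the composite of `φ` with the linear projection given by
the matrix `L`; ramification means the image of the affine tangent cone has rank ≤ `r`. -/
def ProjRamLocus {M N T : ℕ} (X : Set (Pr k M)) (φ : Pr k M → Pr k N)
    (L : Matrix (Fin T) (Fin (N + 1)) k) (r : ℕ) : Set (Pr k M) :=
  {p | p ∈ X ∧ ∀ F, LocalRep X φ p F →
    finrank k ((embTangent X p).map
      ((Matrix.mulVecLin L).comp (jacobian F (Projectivization.rep p)))) ≤ r}

/-- A property holds for a general matrix: it holds on a nonempty Zariski-open set. -/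
def ForGenericMatrix {a b : ℕ} (P : Matrix (Fin a) (Fin b) k → Prop) : Prop :=
  ∃ G : MvPolynomial (Fin a × Fin b) k, G ≠ 0 ∧
    ∀ L : Matrix (Fin a) (Fin b) k, eval (fun ij => L ij.1 ij.2) G ≠ 0 → P L

/-- A property holds for a general vector. -/
def ForGenericVector {b : ℕ} (P : (Fin b → k) → Prop) : Prop :=
  ∃ G : MvPolynomial (Fin b) k, G ≠ 0 ∧ ∀ a : Fin b → k, eval a G ≠ 0 → P a

/-- A property holds for a general point of `X`: it holds away from a proper closed subset. -/
def ForGeneralPointOn {M : ℕ} (X : Set (Pr k M)) (P : Pr k M → Prop) : Prop :=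
  ∃ Z : Set (Pr k M), IsAlgSet Z ∧ ¬ X ⊆ Z ∧ ∀ x ∈ X \ Z, P x

/-- The pinch point scheme length: `𝔓(φ) = n` iff the composition of `φ` with a general
linear projection to `ℙ³` has exactly `n` pinch (ramification) points.  (By
[Eisenbud–Harris, 12.6] this equals `deg (6ζ² + 4ζK + K² − c₂)`.) -/
def HasPinch {M N : ℕ} (X : Set (Pr k M)) (φ : Pr k M → Pr k N) (n : ℕ) : Prop :=
  ForGenericMatrix (fun L : Matrix (Fin 4) (Fin (N + 1)) k =>
    (∀ p ∈ X, L.mulVec (Projectivization.rep (φ p)) ≠ 0) ∧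
    (ProjRamLocus X φ L 2).ncard = n ∧ (ProjRamLocus X φ L 2).Finite)

/-- A rational normal scroll in `ℙ^N`: a smooth non-degenerate surface of minimal
degree `N − 1` which is ruled by lines. -/
def IsRationalNormalScroll {N : ℕ} (Y : Set (Pr k N)) : Prop :=
  IsSmoothSurface Y ∧ Nondegenerate Y ∧ RuledByLines Y ∧ HasDegree Y 2 (N - 1)

/-- The exceptional fiber of `β` over `x`. -/
def ExcFiber {M' M : ℕ} (Xt : Set (Pr k M')) (β : Pr k M' → Pr k M) (x : Pr k M) :
    Set (Pr k M') := {q | q ∈ Xt ∧ β q = x}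

/-- `β : X̃ → X` is the blow-up of the surface `X` at the (smooth) point `x`:
a birational morphism which is an isomorphism away from `x`, whose fiber over `x`
is an irreducible curve, smooth along that fiber. -/
def IsBlowupAt {M' M : ℕ} (Xt : Set (Pr k M')) (X : Set (Pr k M))
    (β : Pr k M' → Pr k M) (x : Pr k M) : Prop :=
  x ∈ X ∧ IsVariety Xt ∧ HasDim Xt 2 ∧ IsMorphismOn Xt β ∧ β '' Xt = X ∧
    InjOn β {q | q ∈ Xt ∧ β q ≠ x} ∧
    IsVariety (ExcFiber Xt β x) ∧ HasDim (ExcFiber Xt β x) 1 ∧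
    ∀ q ∈ ExcFiber Xt β x, finrank k (embTangent Xt q) = 3

/-- `φ̃ : X̃ → ℙ^{N'}` resolves the inner projection of `φ : X → ℙ^N` from `y = φ x`
(via the blow-up `β : X̃ → X` and with projection given by a linear map `L` whose
kernel is the line of `y`). -/
def ResolvesInnerProj {M M' N N' : ℕ} (X : Set (Pr k M)) (φ : Pr k M → Pr k N)
    (x : Pr k M) (Xt : Set (Pr k M')) (β : Pr k M' → Pr k M)
    (φt : Pr k M' → Pr k N') (L : (Fin (N + 1) → k) →ₗ[k] (Fin (N' + 1) → k)) : Prop :=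
  IsMorphismOn Xt φt ∧ LinearMap.ker L = Projectivization.submodule (φ x) ∧
    ∀ q ∈ Xt, β q ≠ x → ∀ (v : Fin (N + 1) → k) (hv : v ≠ 0),
      Projectivization.mk k v hv = φ (β q) → ∀ hLv : L v ≠ 0,
        φt q = Projectivization.mk k (L v) hLv

/-- The standard quadratic (Veronese) monomials. -/
def veroneseVec (v : Fin 3 → k) : Fin 6 → k :=
  ![v 0 * v 0, v 0 * v 1, v 0 * v 2, v 1 * v 1, v 1 * v 2, v 2 * v 2]

/-- The image of the Veronese embedding `ℙ² → ℙ⁵`. -/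
def veroneseImage (k : Type) [Field k] : Set (Pr k 5) :=
  {p | ∃ (v : Fin 3 → k) (hv : veroneseVec v ≠ 0), p = Projectivization.mk k (veroneseVec v) hv}

/-- `Y` is (projectively equivalent to) the Veronese surface in `ℙ⁵`
(the existence of the linear isomorphism forces `N = 5`). -/
def IsVeroneseSurface {N : ℕ} (Y : Set (Pr k N)) : Prop :=
  ∃ σ : (Fin 6 → k) ≃ₗ[k] (Fin (N + 1) → k),
    Y = Projectivization.map σ.toLinearMap σ.injective '' veroneseImage k

/-- `Y ⊂ ℙ^N` is linearly normal: it is not an isomorphic linear projection of a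
non-degenerate variety in `ℙ^{N+1}`. -/
def LinearlyNormal {N : ℕ} (Y : Set (Pr k N)) : Prop :=
  ¬ ∃ (Y' : Set (Pr k (N + 1))) (π : Pr k (N + 1) → Pr k N)
      (L : (Fin (N + 1 + 1) → k) →ₗ[k] (Fin (N + 1) → k)),
      IsVariety Y' ∧ Nondegenerate Y' ∧
      (∀ q ∈ Y', ∀ (v : Fin (N + 1 + 1) → k) (hv : v ≠ 0),
        Projectivization.mk k v hv = q →
          ∃ hLv : L v ≠ 0, π q = Projectivization.mk k (L v) hLv) ∧
      π '' Y' = Y ∧ InjOn π Y' ∧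
      ∀ q ∈ Y', Disjoint (LinearMap.ker L) (embTangent Y' q)

/-- A del Pezzo surface of degree `d` in `ℙ^N`: a smooth non-degenerate linearly normal
surface of degree `d` (for `d = N` this characterizes anticanonically embedded del
Pezzo surfaces). -/
def IsDelPezzoOfDegree {N : ℕ} (Y : Set (Pr k N)) (d : ℕ) : Prop :=
  IsSmoothSurface Y ∧ Nondegenerate Y ∧ LinearlyNormal Y ∧ HasDegree Y 2 d

/-- `F` is isomorphic to `ℙ¹` (as a projective variety). -/
def IsIsoToP1 {M : ℕ} (F : Set (Pr k M)) : Prop :=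
  ∃ ψ : Pr k 1 → Pr k M, IsMorphismOn Set.univ ψ ∧ Set.BijOn ψ Set.univ F ∧
    ∃ ψ' : Pr k M → Pr k 1, IsMorphismOn F ψ' ∧ ∀ t, ψ' (ψ t) = t

/-- `ρ : X → B` exhibits `X` as a `ℙ¹`-bundle over the curve `B`
(all fibers are isomorphic to `ℙ¹`). -/
def IsP1Bundle {M m : ℕ} (X : Set (Pr k M)) (B : Set (Pr k m))
    (ρ : Pr k M → Pr k m) : Prop :=
  IsMorphismOn X ρ ∧ ρ '' X = B ∧ ∀ b ∈ B, IsIsoToP1 {p | p ∈ X ∧ ρ p = b}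

/-- The hyperplane cut out by the linear form with coefficients `a`. -/
def hyperplaneOf {N : ℕ} (a : Fin (N + 1) → k) : Set (Pr k N) :=
  {p | Vanishes (∑ i, MvPolynomial.C (a i) * MvPolynomial.X i) p}

/-- A rational normal curve of degree `N` in `ℙ^N`: a non-degenerate curve of degree `N`. -/
def IsRationalNormalCurve {N : ℕ} (C : Set (Pr k N)) : Prop :=
  IsVariety C ∧ HasDim C 1 ∧ Nondegenerate C ∧ HasDegree C 1 N

/-- The Gauss degree `γ₁` of an embedded curve `X ⊂ ℙ^N`: the number of ramification
points of a general linear projection `X → ℙ¹`. -/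
def HasGaussDegree {N : ℕ} (X : Set (Pr k N)) (γ : ℕ) : Prop :=
  ForGenericMatrix (fun L : Matrix (Fin 2) (Fin (N + 1)) k =>
    (∀ p ∈ X, L.mulVec (Projectivization.rep p) ≠ 0) ∧
    (ProjRamLocus X id L 1).ncard = γ ∧ (ProjRamLocus X id L 1).Finite)

end PinchPaper

section

open TensorProduct

theorem Derivation.exists_extend_field {k A K : Type*} [CommRing k] [CommRing A] [IsDomain A]
    [Field K] [CharZero K] [Algebra k A] [Algebra A K] [Algebra k K] [IsScalarTower k A K]
    (hinj : Function.Injective (algebraMap A K)) (d : Derivation k A K) :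
    ∃ D : Derivation k K K, ∀ a, D (algebraMap A K a) = d a := by
  have : FaithfulSMul A K := (faithfulSMul_iff_algebraMap_injective A K).2 hinj
  let E := FractionRing A
  let _ : Algebra E K := FractionRing.liftAlgebra A K
  have : IsScalarTower A E K := inferInstance
  have : CharZero E := (RingHom.charZero_iff (algebraMap E K).injective).2 inferInstance
  obtain ⟨s, hs⟩ := exists_isTranscendenceBasis E K
  have := hs.isAlgebraic_field
  have : Algebra.FormallySmooth E K := .of_algebraicIndependent_of_isSeparable hs.1
  have : Algebra.FormallySmooth A E := .of_isLocalization (nonZeroDivisors A)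
  have : Algebra.FormallySmooth A K := .comp A E K
  have hi : Function.Injective (KaehlerDifferential.mapBaseChange k A K) := by
    rw [injective_iff_map_eq_zero]
    intro a ha
    obtain ⟨b, rfl⟩ := (Algebra.H1Cotangent.exact_δ_mapBaseChange k A K a).1 ha
    rw [Subsingleton.elim b 0, map_zero]
  obtain ⟨g, hg⟩ := LinearMap.exists_leftInverse_of_injective _ (LinearMap.ker_eq_bot.2 hi)
  let L : K ⊗[A] Ω[A⁄k] →ₗ[K] K := LinearMap.liftBaseChange K d.liftKaehlerDifferential
  refine ⟨(L ∘ₗ g).compDer (KaehlerDifferential.D k K), fun a => ?_⟩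
  have h1 : KaehlerDifferential.D k K (algebraMap A K a) =
      KaehlerDifferential.mapBaseChange k A K (1 ⊗ₜ KaehlerDifferential.D k A a) := by simp
  have h2 := LinearMap.congr_fun hg (1 ⊗ₜ KaehlerDifferential.D k A a)
  simp only [LinearMap.coe_comp, Function.comp_apply, LinearMap.id_apply] at h2
  change L (g (KaehlerDifferential.D k K (algebraMap A K a))) = d a
  rw [h1, h2]
  simp [L]

theorem Derivation.eq_zero_of_isAlgebraic {k R K : Type*} [Field k] [CharZero k] [CommRing R]
    [Field K] [Algebra k R] [Algebra R K] [Algebra k K] [IsScalarTower k R K]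
    (hinj : Function.Injective (algebraMap R K)) (d : Derivation k R K) (S : Subalgebra k R)
    (hS : ∀ s ∈ S, d s = 0) {r : R} (hr : IsAlgebraic S r) : d r = 0 := by
  have : IsDomain R := hinj.isDomain (algebraMap R K)
  have : CharZero S := by
    have : CharZero R := charZero_of_injective_algebraMap (algebraMap k R).injective
    infer_instance
  let d' : Derivation S R K := Derivation.mk'
    { toFun := d
      map_add' := map_add d
      map_smul' := fun s r => by
        rw [Algebra.smul_def, d.leibniz]
        have h0 : d (algebraMap S R s) = 0 := hS _ s.2
        rw [h0, smul_zero, add_zero]; rfl }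
    (fun a b => by simp)
  have hd' : ∀ r, d' r = d r := fun _ => rfl
  by_contra hne
  have key : ∀ n : ℕ, ∀ p : Polynomial S, p.natDegree ≤ n → Polynomial.aeval r p = 0 → p = 0 := by
    intro n
    induction n with
    | zero =>
      intro p hp h
      rw [Polynomial.eq_C_of_natDegree_le_zero hp] at h ⊢
      simp only [Polynomial.aeval_C] at h
      have : p.coeff 0 = 0 := Subtype.ext h
      simp [this]
    | succ n ih =>
      intro p hp h
      have h1 : d' (Polynomial.aeval r p) = 0 := by rw [h, map_zero]
      rw [Derivation.map_aeval, hd', Algebra.smul_def, mul_eq_zero] at h1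
      have h2 : Polynomial.aeval r (Polynomial.derivative p) = 0 := by
        rcases h1 with h1 | h1
        · exact hinj (by simpa using h1)
        · exact absurd h1 hne
      have h3 := ih _ ((Polynomial.natDegree_derivative_le p).trans (by omega)) h2
      have h4 := Polynomial.derivative_eq_zero.1 h3
      exact ih p (by omega) h
  obtain ⟨p, hp0, hp⟩ := hr
  exact hp0 (key _ p le_rfl hp)

theorem exists_algHom_ne_zero {k B : Type*} [Field k] [IsAlgClosed k] [CommRing B] [Algebra k B]
    [Algebra.FiniteType k B] {b : B} (hb : ¬ IsNilpotent b) : ∃ χ : B →ₐ[k] k, χ b ≠ 0 := by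
  let C := Localization.Away b
  have hC : Nontrivial C := by
    by_contra h
    rw [not_nontrivial_iff_subsingleton] at h
    apply hb
    have : algebraMap B C 1 = algebraMap B C 0 := Subsingleton.elim _ _
    obtain ⟨⟨c, n, rfl⟩, hc⟩ := (IsLocalization.eq_iff_exists (.powers b) C).1 this
    exact ⟨n, by simpa using hc⟩
  have : Algebra.FiniteType B C := IsLocalization.finiteType_of_monoid_fg (.powers b) C
  have : Algebra.FiniteType k C := .trans (S := B) inferInstance inferInstance
  obtain ⟨m, hm⟩ := Ideal.exists_maximal C
  let _ := Ideal.Quotient.field m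
  have : Algebra.FiniteType k (C ⧸ m) := inferInstance
  have : Module.Finite k (C ⧸ m) := finite_of_finite_type_of_isJacobsonRing k (C ⧸ m)
  let e : (C ⧸ m) →ₐ[k] k := IsAlgClosed.lift
  refine ⟨(e.comp (Ideal.Quotient.mkₐ k m)).comp (IsScalarTower.toAlgHom k B C), ?_⟩
  have h1 : IsUnit (algebraMap B C b) := IsLocalization.Away.algebraMap_isUnit b
  exact ((h1.map (Ideal.Quotient.mkₐ k m)).map e).ne_zero

theorem sub_tmul_pow_ne_zero {S R L K : Type*} [CommRing S] [CommRing R] [Field L] [Field K]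
    [Algebra S R] [Algebra S L] [Algebra L K] [Algebra R K] [Algebra S K] [IsScalarTower S L K]
    [IsScalarTower S R K] {r : R} (htr' : Transcendental L (algebraMap R K r)) (m : ℕ) :
    (r ⊗ₜ[S] (1 : R) - (1 : R) ⊗ₜ[S] r) ^ m ≠ 0 := by
  intro hm
  have hli : LinearIndependent L (fun i : ℕ => algebraMap R K r ^ i) := by
    have h1 := (Polynomial.basisMonomials L).linearIndependent.map'
      (Polynomial.aeval (R := L) (algebraMap R K r)).toLinearMap
      (LinearMap.ker_eq_bot.2 (transcendental_iff_injective.1 htr'))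
    have h2 : (fun i : ℕ => algebraMap R K r ^ i) =
        (Polynomial.aeval (R := L) (algebraMap R K r)).toLinearMap ∘
          (Polynomial.basisMonomials L) := by
      ext i
      simp
    rw [h2]
    exact h1
  let b := Basis.extend hli.linearIndepOn_id
  let lam : K →ₗ[L] L := b.constr L
    (fun v => open Classical in if (v : K) = algebraMap R K r ^ m then 1 else 0)
  have hlam : ∀ i, lam (algebraMap R K r ^ i) = if i = m then 1 else 0 := by
    intro i
    have h1 : algebraMap R K r ^ i ∈ hli.linearIndepOn_id.extend (Set.subset_univ _) :=
      hli.linearIndepOn_id.subset_extend _ ⟨i, rfl⟩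
    have h2 : b ⟨_, h1⟩ = algebraMap R K r ^ i := Basis.extend_apply_self _ _
    rw [← h2, Basis.constr_basis]
    simp only
    congr 1
    exact propext ⟨fun h => hli.injective h, fun h => by rw [h]⟩
  let Φ : R ⊗[S] R →ₗ[S] K := TensorProduct.lift (LinearMap.mk₂ S
    (fun x y => algebraMap L K (lam (algebraMap R K x)) * algebraMap R K y)
    (fun x x' y => by simp [add_mul])
    (fun c x y => by
      have h1 : algebraMap R K (c • x) = c • algebraMap R K x := by
        rw [Algebra.smul_def, map_mul, Algebra.smul_def, ← IsScalarTower.algebraMap_apply S R K]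
      rw [h1, LinearMap.map_smul_of_tower]
      simp only [Algebra.smul_def, map_mul, mul_assoc, ← IsScalarTower.algebraMap_apply S L K])
    (fun x y y' => by simp [mul_add])
    (fun c x y => by
      have h1 : algebraMap R K (c • y) = c • algebraMap R K y := by
        rw [Algebra.smul_def, map_mul, Algebra.smul_def, ← IsScalarTower.algebraMap_apply S R K]
      simp only [h1, mul_smul_comm]))
  have h1 : Φ ((r ⊗ₜ[S] (1 : R) - (1 : R) ⊗ₜ[S] r) ^ m) = 1 := by
    rw [sub_eq_add_neg, ← TensorProduct.tmul_neg, add_pow, map_sum, Finset.sum_eq_single m]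
    · simp [Φ, hlam, Algebra.TensorProduct.tmul_pow, Algebra.TensorProduct.one_def]
    · intro i _ hi
      have h3 : ∀ c : ℕ, (c : R ⊗[S] R) = (1 : R) ⊗ₜ (c : R) := by
        intro c
        rw [← nsmul_one c, ← nsmul_one (A := R) c, Algebra.TensorProduct.one_def,
          TensorProduct.tmul_smul]
      simp [Φ, hlam, Algebra.TensorProduct.tmul_pow, hi, h3]
    · simp
  rw [hm, map_zero] at h1
  exact zero_ne_one h1

theorem isAlgebraic_of_separates_points {k R : Type*} [Field k] [IsAlgClosed k] [CommRing R]
    [IsDomain R] [Algebra k R] [Algebra.FiniteType k R] (S : Subalgebra k R)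
    (hinj : ∀ x y : R →ₐ[k] k, (∀ s ∈ S, x s = y s) → x = y) : Algebra.IsAlgebraic S R := by
  refine ⟨fun r => ?_⟩
  by_contra hr
  have htr : Transcendental S r := hr
  have : Algebra.FiniteType S R := .of_restrictScalars_finiteType k S R
  have : Algebra.FiniteType k (R ⊗[S] R) := .trans (S := R) inferInstance inferInstance
  have hnil : IsNilpotent (r ⊗ₜ[S] (1 : R) - (1 : R) ⊗ₜ[S] r) := by
    by_contra h
    obtain ⟨χ, hχ⟩ := exists_algHom_ne_zero (k := k) h
    let x : R →ₐ[k] k := χ.comp ((Algebra.TensorProduct.includeLeft (R := S) (S := S)).restrictScalars k)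
    let y : R →ₐ[k] k := χ.comp ((Algebra.TensorProduct.includeRight (R := S)).restrictScalars k)
    have hxy : x = y := hinj x y fun s hs => by
      have h2 : (s : R) ⊗ₜ[S] (1 : R) = 1 ⊗ₜ s := by
        have := TensorProduct.smul_tmul (R := S) (⟨s, hs⟩ : S) (1 : R) (1 : R)
        simpa [Algebra.smul_def] using this
      simp [x, y, h2]
    have := DFunLike.congr_fun hxy r
    simp only [x, y, AlgHom.comp_apply, AlgHom.restrictScalars_apply,
      Algebra.TensorProduct.includeLeft_apply, Algebra.TensorProduct.includeRight_apply] at this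
    rw [map_sub, this, sub_self] at hχ
    exact hχ rfl
  obtain ⟨m, hm⟩ := hnil
  let L := FractionRing S
  let K := FractionRing R
  have : FaithfulSMul S K := FaithfulSMul.trans S R K
  let _ : Algebra L K := FractionRing.liftAlgebra S K
  have htr' : Transcendental L (algebraMap R K r) := by
    have h1 : Transcendental S (algebraMap R K r) :=
      (transcendental_algebraMap_iff (IsFractionRing.injective R K)).2 htr
    intro h
    exact h1 ((IsFractionRing.isAlgebraic_iff S L K).2 h)
  exact sub_tmul_pow_ne_zero htr' m hm

/-- The derivations of `R` dual to a basis of its module of differentials. -/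
noncomputable def Module.Basis.partialDer {k R ι : Type*} [CommRing k] [CommRing R] [Algebra k R]
    (b : Basis ι R Ω[R⁄k]) (i : ι) : Derivation k R R :=
  (b.coord i).compDer (KaehlerDifferential.D k R)

theorem Module.Basis.derivation_eq_sum {k R ι K : Type*} [CommRing k] [CommRing R] [Algebra k R]
    [Fintype ι] (b : Basis ι R Ω[R⁄k]) [CommRing K] [Algebra k K] [Algebra R K]
    [IsScalarTower k R K] (d : Derivation k R K) :
    ∃ c : ι → K, ∀ r, d r = ∑ i, c i * algebraMap R K (b.partialDer i r) := by
  refine ⟨fun i => d.liftKaehlerDifferential (b i), fun r => ?_⟩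
  have h := congrArg d.liftKaehlerDifferential (b.sum_repr (KaehlerDifferential.D k R r))
  rw [d.liftKaehlerDifferential_comp_D] at h
  rw [← h, map_sum]
  simp [Basis.partialDer, Algebra.smul_def, mul_comm]

theorem Module.Basis.eq_zero_of_sum_partialDer_eq_zero {k R ι K : Type*} [Field k] [CharZero k]
    [CommRing R] [Algebra k R] [Fintype ι] (b : Basis ι R Ω[R⁄k]) [Field K] [Algebra k K]
    [Algebra R K] [IsScalarTower k R K] (hinj : Function.Injective (algebraMap R K))
    (S : Subalgebra k R) (hS : Algebra.IsAlgebraic S R) (s : Set R)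
    (hs : S = Algebra.adjoin k s) (c : ι → K)
    (h : ∀ r ∈ s, ∑ i, c i * algebraMap R K (b.partialDer i r) = 0) : c = 0 := by
  let lam : Ω[R⁄k] →ₗ[R] K := b.constr R c
  let d : Derivation k R K := lam.compDer (KaehlerDifferential.D k R)
  have hd : ∀ r, d r = ∑ i, c i * algebraMap R K (b.partialDer i r) := fun r => by
    simp [d, lam, Basis.constr_apply_fintype, Basis.partialDer, Algebra.smul_def, mul_comm]
  have hS0 : ∀ r ∈ S, d r = 0 := by
    intro r hr
    rw [hs] at hr
    induction hr using Algebra.adjoin_induction with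
    | mem x hx => rw [hd]; exact h x hx
    | algebraMap x => simp
    | add x y _ _ hx hy => rw [map_add, hx, hy, add_zero]
    | mul x y _ _ hx hy => rw [d.leibniz, hx, hy, smul_zero, smul_zero, add_zero]
  have h0 : ∀ r, d r = 0 := fun r => d.eq_zero_of_isAlgebraic hinj S hS0 (hS.isAlgebraic r)
  have hlam : lam = 0 := by
    apply LinearMap.ext_on_range (KaehlerDifferential.span_range_derivation k R)
    exact fun r => h0 r
  funext i
  have : lam (b i) = c i := b.constr_basis R c i
  rw [← this, hlam]; rfl

/-- A function all of whose partial derivatives vanish is constant. -/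
theorem Module.Basis.exists_eq_smul_of_partialDer {k R ι : Type*} [Field k] [IsAlgClosed k]
    [CharZero k] [CommRing R] [IsDomain R] [Algebra k R] [Fintype ι] (b : Basis ι R Ω[R⁄k])
    {g₁ g₂ : R} (hg : g₂ ≠ 0) (h : ∀ i, b.partialDer i g₁ * g₂ = b.partialDer i g₂ * g₁) :
    ∃ c : k, g₁ = c • g₂ := by
  let K := FractionRing R
  have hinj : Function.Injective (algebraMap R K) := IsFractionRing.injective R K
  have hg' : algebraMap R K g₂ ≠ 0 := by simpa using hg
  set u : K := algebraMap R K g₁ / algebraMap R K g₂ with hu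
  by_cases hu' : IsAlgebraic k u
  · obtain ⟨c, hc⟩ : ∃ c : k, algebraMap k K c = u := by
      have h1 := IsAlgClosed.degree_eq_one_of_irreducible k (minpoly.irreducible hu'.isIntegral)
      have := minpoly.mem_range_of_degree_eq_one k u h1
      exact this
    refine ⟨c, hinj ?_⟩
    rw [Algebra.smul_def, map_mul, ← IsScalarTower.algebraMap_apply, hc, hu, div_mul_cancel₀ _ hg']
  · exfalso
    have htr := transcendental_iff_injective.1 hu'
    let _ : Algebra (Polynomial k) K := (Polynomial.aeval (R := k) u).toAlgebra
    have : IsScalarTower k (Polynomial k) K := .of_algebraMap_eq' <| by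
      ext x
      simp [RingHom.algebraMap_toAlgebra]
    have : CharZero K := (RingHom.charZero_iff (algebraMap k K).injective).1 inferInstance
    obtain ⟨D, hD⟩ := Derivation.exists_extend_field (k := k) (A := Polynomial k) (K := K) htr
      (Polynomial.mkDerivation k (1 : K))
    have hDu : D u = 1 := by
      have := hD Polynomial.X
      rw [Polynomial.mkDerivation_X] at this
      rw [← this]
      congr 1
      simp [RingHom.algebraMap_toAlgebra]
    obtain ⟨c, hc⟩ := b.derivation_eq_sum (D.compAlgebraMap R)
    simp only [Derivation.compAlgebraMap_apply] at hc
    have h1 : algebraMap R K g₁ = u * algebraMap R K g₂ := by rw [hu, div_mul_cancel₀ _ hg']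
    have h2 : D (algebraMap R K g₁) * algebraMap R K g₂ = D (algebraMap R K g₂) * algebraMap R K g₁ := by
      rw [hc, hc, Finset.sum_mul, Finset.sum_mul]
      refine Finset.sum_congr rfl fun i _ => ?_
      rw [mul_assoc, mul_assoc, ← map_mul, ← map_mul, h]
    rw [h1, D.leibniz, hDu] at h2
    simp only [smul_eq_mul, mul_one] at h2
    have : algebraMap R K g₂ * algebraMap R K g₂ = 0 := by linear_combination h2
    exact hg' (mul_self_eq_zero.1 this)

/-- A derivation of the second factor, extended to a field containing `R ⊗ R`. -/
theorem exists_derivation_of_productMap_injective {k R K : Type*} [Field k] [CommRing R]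
    [Algebra k R] [Field K] [CharZero K] [Algebra k K] (x z : R →ₐ[k] K)
    (hinj : Function.Injective (Algebra.TensorProduct.productMap x z)) (d : Derivation k R R) :
    ∃ D : Derivation k K K, (∀ r, D (x r) = 0) ∧ ∀ r, D (z r) = z (d r) := by
  have : IsDomain (R ⊗[k] R) := hinj.isDomain (Algebra.TensorProduct.productMap x z).toRingHom
  let _ : Algebra (R ⊗[k] R) K := (Algebra.TensorProduct.productMap x z).toAlgebra
  have hmap : ∀ a, algebraMap (R ⊗[k] R) K a = Algebra.TensorProduct.productMap x z a :=
    fun _ => rfl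
  have : IsScalarTower k (R ⊗[k] R) K := .of_algebraMap_eq fun c => by rw [hmap]; simp
  let L : R ⊗[k] R →ₗ[k] K :=
    LinearMap.mul' k K ∘ₗ TensorProduct.map x.toLinearMap (z.toLinearMap ∘ₗ d.toLinearMap)
  have hL : ∀ a c, L (a ⊗ₜ c) = x a * z (d c) := fun a c => by simp [L]
  have hleib : ∀ a c, L (a * c) = a • L c + c • L a := by
    intro a c
    simp only [Algebra.smul_def, hmap]
    induction a with
    | zero => simp
    | add a a' ha ha' => simp only [add_mul, map_add, ha, ha', mul_add]; ring
    | tmul a a' =>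
      induction c with
      | zero => simp
      | add c c' hc hc' => simp only [add_mul, map_add, hc, hc', mul_add]; ring
      | tmul c c' => simp [hL]; ring
  obtain ⟨D, hD⟩ := Derivation.exists_extend_field (k := k) (A := R ⊗[k] R) (K := K) hinj
    (Derivation.mk' L hleib)
  replace hD : ∀ a, D (Algebra.TensorProduct.productMap x z a) = L a := hD
  refine ⟨D, fun r => ?_, fun r => ?_⟩
  · have := hD (r ⊗ₜ 1)
    simpa [hL] using this
  · have := hD (1 ⊗ₜ r)
    simpa [hL] using this

theorem TensorProduct.exists_algHom_map_ne_zero {k A R : Type*} [Field k] [IsAlgClosed k]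
    [CommRing A] [Algebra k A] [CommRing R] [IsDomain R] [Algebra k R] [Algebra.FiniteType k R]
    {a : A ⊗[k] R} (ha : a ≠ 0) :
    ∃ r : R, r ≠ 0 ∧ ∀ z : R →ₐ[k] k, z r ≠ 0 →
      Algebra.TensorProduct.lift (AlgHom.id k A) ((Algebra.ofId k A).comp z)
        (fun _ _ => .all _ _) a ≠ 0 := by
  classical
  let b := Basis.ofVectorSpace k A
  have h1 : equivFinsuppOfBasisLeft b a ≠ 0 := by simpa using ha
  obtain ⟨i, hi⟩ := Finsupp.ne_iff.1 h1
  refine ⟨_, hi, fun z hz h0 => hz ?_⟩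
  have key : ∀ c : A ⊗[k] R, z (equivFinsuppOfBasisLeft b c i) =
      b.coord i (Algebra.TensorProduct.lift (AlgHom.id k A) ((Algebra.ofId k A).comp z)
        (fun _ _ => .all _ _) c) := by
    intro c
    induction c with
    | zero => simp
    | add x y hx hy => simp only [map_add, Finsupp.add_apply, hx, hy]
    | tmul x y =>
      have : x * algebraMap k A (z y) = z y • x := by rw [_root_.Algebra.smul_def, mul_comm]
      simp [Algebra.ofId_apply, this, mul_comm]
  rw [key, h0, map_zero]

theorem TensorProduct.isDomain_of_isAlgClosed {k A R : Type*} [Field k] [IsAlgClosed k]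
    [CommRing A] [IsDomain A] [Algebra k A] [CommRing R] [IsDomain R] [Algebra k R]
    [Algebra.FiniteType k R] : IsDomain (A ⊗[k] R) := by
  have : Nontrivial (A ⊗[k] R) := Algebra.TensorProduct.includeLeft_injective
    (S := k) (FaithfulSMul.algebraMap_injective k R) |>.nontrivial (β := A ⊗[k] R) (α := A)
  have : NoZeroDivisors (A ⊗[k] R) := ⟨fun {a c} hac => by
    by_contra! h
    obtain ⟨r, hr, hr'⟩ := exists_algHom_map_ne_zero h.1
    obtain ⟨s, hs, hs'⟩ := exists_algHom_map_ne_zero h.2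
    obtain ⟨z, hz⟩ := exists_algHom_ne_zero (k := k) (b := r * s)
      (fun h => mul_ne_zero hr hs h.eq_zero)
    rw [map_mul] at hz
    refine mul_ne_zero (hr' z (left_ne_zero_of_mul hz)) (hs' z (right_ne_zero_of_mul hz)) ?_
    rw [← map_mul, hac, map_zero]⟩
  exact NoZeroDivisors.to_isDomain _

theorem exists_generic_collinear {k R ι : Type} [Field k] [IsAlgClosed k] [CommRing R] [IsDomain R]
    [Algebra k R] [Algebra.FiniteType k R] (f : ι → R)
    (h : ∀ D : R ⊗[k] R, D ≠ 0 → ∃ (x z w : R →ₐ[k] k) (t : k), t ≠ 0 ∧ t ≠ 1 ∧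
      (∀ l, w (f l) = (1 - t) * x (f l) + t * z (f l)) ∧
      Algebra.TensorProduct.productMap x z D ≠ 0) :
    ∃ (K : Type) (_ : Field K) (_ : Algebra k K) (x z w : R →ₐ[k] K) (t : K), t ≠ 0 ∧ t ≠ 1 ∧
      (∀ l, w (f l) = (1 - t) * x (f l) + t * z (f l)) ∧
      Function.Injective (Algebra.TensorProduct.productMap x z) := by
  let T := {q : ((R →ₐ[k] k) × (R →ₐ[k] k)) × (R →ₐ[k] k) × k // q.2.2 ≠ 0 ∧ q.2.2 ≠ 1 ∧
    ∀ l, q.2.1 (f l) = (1 - q.2.2) * q.1.1 (f l) + q.2.2 * q.1.2 (f l)}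
  let P := T → k
  let x₀ : R →ₐ[k] P := AlgHom.pi fun q => q.1.1.1
  let z₀ : R →ₐ[k] P := AlgHom.pi fun q => q.1.1.2
  let w₀ : R →ₐ[k] P := AlgHom.pi fun q => q.1.2.1
  let t₀ : P := fun q => q.1.2.2
  let ψ := Algebra.TensorProduct.productMap x₀ z₀
  have hψ : ∀ D q, ψ D q = Algebra.TensorProduct.productMap q.1.1.1 q.1.1.2 D := by
    intro D q
    have : (Pi.evalAlgHom k (fun _ : T => k) q).comp ψ =
        Algebra.TensorProduct.productMap q.1.1.1 q.1.1.2 := by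
      ext <;> simp [ψ, x₀, z₀, AlgHom.pi]
    exact DFunLike.congr_fun this D
  have hinj : Function.Injective ψ.toRingHom := by
    rw [injective_iff_map_eq_zero]
    intro D hD
    by_contra hD0
    obtain ⟨x, z, w, t, ht0, ht1, hrel, hne⟩ := h D hD0
    refine hne ?_
    rw [← hψ D ⟨((x, z), w, t), ht0, ht1, hrel⟩]
    exact congrFun hD _
  have : IsDomain (R ⊗[k] R) := TensorProduct.isDomain_of_isAlgClosed
  obtain ⟨p, hp, hcomap⟩ := Ideal.exists_comap_eq_of_mem_minimalPrimes_of_injective hinj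
    (⊥ : Ideal (R ⊗[k] R)) (by rw [IsDomain.minimalPrimes_eq_singleton_bot]; rfl)
  obtain ⟨K, _, _, π, hπ⟩ : ∃ (K : Type) (_ : Field K) (_ : Algebra k K) (π : P →ₐ[k] K),
      ∀ a, π a = 0 ↔ a ∈ p :=
    ⟨FractionRing (P ⧸ p), inferInstance, inferInstance,
      (IsScalarTower.toAlgHom k (P ⧸ p) _).comp (Ideal.Quotient.mkₐ k p), fun a => by
        rw [← Ideal.Quotient.eq_zero_iff_mem]
        simp⟩
  have hunit : ∀ a : P, (∀ q, a q ≠ 0) → π a ≠ 0 := by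
    intro a ha
    have : IsUnit a := isUnit_iff_exists_inv.2 ⟨fun q => (a q)⁻¹, by
      funext q; exact mul_inv_cancel₀ (ha q)⟩
    exact (this.map π).ne_zero
  refine ⟨K, inferInstance, inferInstance, π.comp x₀, π.comp z₀, π.comp w₀,
    π t₀, hunit _ fun q => q.2.1, fun h1 => hunit (t₀ - 1) (fun q => sub_ne_zero.2 q.2.2.1) ?_,
    fun l => ?_, ?_⟩
  · rw [map_sub, h1, map_one, sub_self]
  · have : w₀ (f l) = (1 - t₀) * x₀ (f l) + t₀ * z₀ (f l) := by
      funext q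
      exact q.2.2.2 l
    simp [this]
  · have : Algebra.TensorProduct.productMap (π.comp x₀) (π.comp z₀) = π.comp ψ := by
      ext <;> simp [ψ]
    rw [this, injective_iff_map_eq_zero]
    intro D hD
    rw [AlgHom.comp_apply, hπ] at hD
    have : D ∈ p.comap ψ.toRingHom := hD
    rwa [hcomap] at this

theorem LinearIndependent.eq_zero_of_sum_tmul {k A B ι : Type*} [Field k] [AddCommGroup A]
    [Module k A] [AddCommGroup B] [Module k B] [Fintype ι] {f : ι → A} (hf : LinearIndependent k f)
    (g : ι → B) (h : ∑ l, f l ⊗ₜ[k] g l = 0) : g = 0 := by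
  obtain ⟨κ, a, y, hy, ha⟩ :=
    TensorProduct.vanishesTrivially_of_sum_tmul_eq_zero_of_rTensor_injective k
      (Module.Flat.rTensor_preserves_injective_linearMap _ (Submodule.subtype_injective _)) h
  funext l
  rw [hy]
  refine Finset.sum_eq_zero fun j _ => ?_
  rw [Fintype.linearIndependent_iff.1 hf (fun l => a l j) (ha j) l, zero_smul]

theorem exists_ne_zero_minor {R ι : Type*} [CommRing R] [IsDomain R] {l₁ l₂ : ι → R}
    (h : LinearIndependent R ![l₁, l₂]) : ∃ i j, l₁ i * l₂ j - l₁ j * l₂ i ≠ 0 := by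
  by_contra! h0
  have h1 : l₁ ≠ 0 := h.ne_zero 0
  obtain ⟨i, hi⟩ := Function.ne_iff.1 h1
  refine hi (LinearIndependent.pair_iff.1 h (-l₂ i) (l₁ i) ?_).2
  funext j
  have := h0 i j
  simp only [Pi.add_apply, Pi.smul_apply, smul_eq_mul, Pi.zero_apply]
  linear_combination this

theorem exists_pair_mem_ker {R ι κ : Type} [CommRing R] [IsDomain R] [Fintype ι] [Fintype κ]
    (hcard : Fintype.card κ + 2 ≤ Fintype.card ι) (u : (ι → R) →ₗ[R] (κ → R)) :
    ∃ l₁ l₂ : ι → R, LinearIndependent R ![l₁, l₂] ∧ u l₁ = 0 ∧ u l₂ = 0 := by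
  have h1 := u.rank_range_add_rank_ker
  have h2 : Module.rank R (LinearMap.range u) ≤ Fintype.card κ := by
    simpa using Submodule.rank_le (LinearMap.range u)
  rw [rank_fun'] at h1
  have h3 : (2 : ℕ) ≤ finrank R (LinearMap.ker u) := by
    have hfin : Module.rank R (LinearMap.ker u) < Cardinal.aleph0 := by
      refine lt_of_le_of_lt (Submodule.rank_le _) ?_
      rw [rank_fun']
      exact Cardinal.natCast_lt_aleph0
    have hfin' : Module.rank R (LinearMap.range u) < Cardinal.aleph0 :=
      lt_of_le_of_lt h2 Cardinal.natCast_lt_aleph0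
    obtain ⟨a, ha⟩ := Cardinal.lt_aleph0.1 hfin
    obtain ⟨c, hc⟩ := Cardinal.lt_aleph0.1 hfin'
    rw [finrank, ha, Cardinal.toNat_natCast]
    rw [ha, hc] at h1
    rw [hc] at h2
    norm_cast at h1 h2
    omega
  obtain ⟨v, hv⟩ := exists_linearIndependent_of_le_finrank h3
  have h4 := hv.map' (LinearMap.ker u).subtype (Submodule.ker_subtype _)
  refine ⟨v 0, v 1, ?_, (v 0).2, (v 1).2⟩
  have : ![(v 0 : ι → R), v 1] = (LinearMap.ker u).subtype ∘ v := by
    funext i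
    fin_cases i <;> rfl
  rwa [this]

section CollinearTangents

variable {k R K ι : Type} {n : ℕ} [Field k] [CharZero k] [CommRing R] [Algebra k R]
  [Field K] [Algebra k K]

theorem mem_of_collinear (b : Basis (Fin n) R Ω[R⁄k]) (f : ι → R) (x z w : R →ₐ[k] K) {t : K}
    (ht0 : t ≠ 0) (hrel : ∀ l, w (f l) = (1 - t) * x (f l) + t * z (f l))
    (hinj : Function.Injective (Algebra.TensorProduct.productMap x z))
    (Q : Submodule K (ι → K)) (hx : (fun l => x (f l)) ∈ Q) (hw : (fun l => w (f l)) ∈ Q)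
    (hdw : ∀ i, (fun l => w (b.partialDer i (f l))) ∈ Q) :
    (fun l => z (f l)) ∈ Q ∧ ∀ j, (fun l => z (b.partialDer j (f l))) ∈ Q := by
  have : CharZero K := (RingHom.charZero_iff (algebraMap k K).injective).1 inferInstance
  have hz : (fun l => z (f l)) ∈ Q := by
    have : (fun l => z (f l)) = t⁻¹ • ((fun l => w (f l)) - (1 - t) • fun l => x (f l)) := by
      funext l
      simp only [Pi.smul_apply, Pi.sub_apply, smul_eq_mul, hrel]
      field_simp
      ring
    rw [this]
    exact Q.smul_mem _ (Q.sub_mem hw (Q.smul_mem _ hx))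
  refine ⟨hz, fun j => ?_⟩
  obtain ⟨D, hDx, hDz⟩ := exists_derivation_of_productMap_injective x z hinj (b.partialDer j)
  let _ : Algebra R K := w.toAlgebra
  have : IsScalarTower k R K := .of_algebraMap_eq fun c => (w.commutes c).symm
  obtain ⟨c, hc⟩ := b.derivation_eq_sum (D.compAlgebraMap R)
  replace hc : ∀ r, D (w r) = ∑ i, c i * w (b.partialDer i r) := hc
  have : (fun l => z (b.partialDer j (f l))) = t⁻¹ • ((∑ i, c i • fun l => w (b.partialDer i (f l)))
      + D t • (fun l => x (f l)) - D t • fun l => z (f l)) := by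
    funext l
    have h1 := congrArg D (hrel l)
    rw [hc] at h1
    simp only [map_add, D.leibniz, map_sub, D.map_one_eq_zero, hDx, hDz, smul_eq_mul] at h1
    simp only [Pi.smul_apply, Pi.sub_apply, Pi.add_apply, Finset.sum_apply, smul_eq_mul, h1]
    field_simp
    ring
  rw [this]
  exact Q.smul_mem _ (Q.sub_mem (Q.add_mem (Q.sum_mem fun i _ => Q.smul_mem _ (hdw i))
    (Q.smul_mem _ hx)) (Q.smul_mem _ hz))

theorem mem_span_of_collinear [IsAlgClosed k] [IsDomain R] [Algebra.FiniteType k R] [Fintype ι]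
    (b : Basis (Fin n) R Ω[R⁄k]) (f : ι → R) (j₀ : ι) (hj₀ : f j₀ = 1)
    (hf : LinearIndependent k f)
    (hsep : ∀ x y : R →ₐ[k] k, (∀ l, x (f l) = y (f l)) → x = y)
    (x z w : R →ₐ[k] K) {t : K} (ht0 : t ≠ 0) (ht1 : t ≠ 1)
    (hrel : ∀ l, w (f l) = (1 - t) * x (f l) + t * z (f l))
    (hinj : Function.Injective (Algebra.TensorProduct.productMap x z))
    {ℓ : ι → R} (hℓ : ℓ ≠ 0) (hℓf : ∑ l, ℓ l * f l = 0)
    (hℓd : ∀ i, ∑ l, ℓ l * b.partialDer i (f l) = 0) (j : Fin n) :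
    ∃ α : K, ∀ ℓ' : ι → R, (∑ l, ℓ' l * f l = 0) → (∀ i, ∑ l, ℓ' l * b.partialDer i (f l) = 0) →
      ∑ l, z (ℓ' l) * x (b.partialDer j (f l)) = α * ∑ l, z (ℓ' l) * x (f l) := by
  let Q : Submodule K (ι → K) := Submodule.span K (Set.range fun o : Option (Option (Fin n)) =>
    o.elim (fun l => x (f l)) fun o => o.elim (fun l => w (f l)) fun i l => w (b.partialDer i (f l)))
  have hxQ : (fun l => x (f l)) ∈ Q := Submodule.subset_span ⟨none, rfl⟩
  have hwQ : (fun l => w (f l)) ∈ Q := Submodule.subset_span ⟨some none, rfl⟩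
  have hdwQ : ∀ i, (fun l => w (b.partialDer i (f l))) ∈ Q :=
    fun i => Submodule.subset_span ⟨some (some i), rfl⟩
  obtain ⟨hzQ, hdzQ⟩ := mem_of_collinear b f x z w ht0 hrel hinj Q hxQ hwQ hdwQ
  have hdxQ := (mem_of_collinear b f z x w (t := 1 - t) (sub_ne_zero.2 ht1.symm)
    (fun l => by rw [hrel]; ring) (by
      have : Algebra.TensorProduct.productMap z x = (Algebra.TensorProduct.productMap x z).comp
          (Algebra.TensorProduct.comm k R R).toAlgHom := by ext <;> simp
      rw [this]
      exact hinj.comp (Algebra.TensorProduct.comm k R R).injective) Q hzQ hwQ hdwQ).2 j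
  have hzinj : Function.Injective z := by
    rw [injective_iff_map_eq_zero]
    intro r hr
    have h1 : Algebra.TensorProduct.productMap x z ((1 : R) ⊗ₜ r) = 0 := by simp [hr]
    rw [map_eq_zero_iff _ hinj] at h1
    have := LinearIndependent.eq_zero_of_sum_tmul (k := k) (ι := Unit) (f := fun _ => (1 : R))
      (by simp) (fun _ => r) (by simpa using h1)
    exact congrFun this ()
  let v : Option (Option (Fin n)) → ι → K := fun o => o.elim (fun l => x (f l)) fun o =>
    o.elim (fun l => z (f l)) fun i l => z (b.partialDer i (f l))
  have hli : LinearIndependent K v := by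
    refine linearIndependent_option.2 ⟨linearIndependent_option.2 ⟨?_, ?_⟩, ?_⟩
    · rw [Fintype.linearIndependent_iff]
      intro c hc
      let _ : Algebra R K := z.toAlgebra
      have : IsScalarTower k R K := .of_algebraMap_eq fun c => (z.commutes c).symm
      refine congrFun (b.eq_zero_of_sum_partialDer_eq_zero (K := K) hzinj
        (Algebra.adjoin k (Set.range f)) (isAlgebraic_of_separates_points _ fun x y hxy => ?_) _ rfl
        c ?_)
      · exact hsep x y fun l => hxy _ (Algebra.subset_adjoin ⟨l, rfl⟩)
      · rintro _ ⟨l, rfl⟩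
        have := congrFun hc l
        change ∑ i, c i * z (b.partialDer i (f l)) = 0
        simpa [v] using this
    · intro hmem
      have : ∀ u ∈ Submodule.span K (Set.range ((v ∘ some) ∘ some)), u j₀ = 0 := by
        intro u hu
        induction hu using Submodule.span_induction with
        | mem u hu => obtain ⟨i, rfl⟩ := hu; simp [v, hj₀]
        | zero => rfl
        | add u u' _ _ hu hu' => simp [hu, hu']
        | smul a u _ hu => simp [hu]
      have := this _ hmem
      simp [v, hj₀] at this
    · intro hmem
      have : ∀ u ∈ Submodule.span K (Set.range (v ∘ some)), ∑ l, z (ℓ l) * u l = 0 := by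
        intro u hu
        induction hu using Submodule.span_induction with
        | mem u hu =>
          obtain ⟨_ | i, rfl⟩ := hu
          · simpa [v] using congrArg z hℓf
          · simpa [v] using congrArg z (hℓd i)
        | zero => simp
        | add u u' _ _ hu hu' => simp [mul_add, Finset.sum_add_distrib, hu, hu']
        | smul a u _ hu =>
          simp only [Pi.smul_apply, smul_eq_mul, mul_left_comm _ a, ← Finset.mul_sum, hu, mul_zero]
      have := this _ hmem
      refine hℓ (hf.eq_zero_of_sum_tmul ℓ (hinj ?_))
      simp only [map_sum, Algebra.TensorProduct.productMap_apply_tmul, map_zero]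
      simpa [v, mul_comm] using this
  have hspan : Submodule.span K (Set.range v) = Q := by
    refine Submodule.eq_of_le_of_finrank_le (Submodule.span_le.2 ?_) ?_
    · rintro _ ⟨_ | _ | i, rfl⟩
      · exact hxQ
      · exact hzQ
      · exact hdzQ i
    · rw [finrank_span_eq_card hli]
      exact finrank_range_le_card _
  rw [← hspan] at hdxQ
  have key : ∀ u ∈ Submodule.span K (Set.range v), ∃ α : K, ∀ ℓ' : ι → R, (∑ l, ℓ' l * f l = 0) →
      (∀ i, ∑ l, ℓ' l * b.partialDer i (f l) = 0) →
      ∑ l, z (ℓ' l) * u l = α * ∑ l, z (ℓ' l) * x (f l) := by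
    intro u hu
    induction hu using Submodule.span_induction with
    | mem u hu =>
      obtain ⟨_ | _ | i, rfl⟩ := hu
      · exact ⟨1, fun ℓ' _ _ => by simp [v]⟩
      · exact ⟨0, fun ℓ' h _ => by simpa [v] using congrArg z h⟩
      · exact ⟨0, fun ℓ' _ h => by simpa [v] using congrArg z (h i)⟩
    | zero => exact ⟨0, by simp⟩
    | add u u' _ _ hu hu' =>
      obtain ⟨α, hα⟩ := hu
      obtain ⟨α', hα'⟩ := hu'
      refine ⟨α + α', fun ℓ' h h' => ?_⟩
      simp [mul_add, Finset.sum_add_distrib, hα ℓ' h h', hα' ℓ' h h', add_mul]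
    | smul a u _ hu =>
      obtain ⟨α, hα⟩ := hu
      refine ⟨a * α, fun ℓ' h h' => ?_⟩
      simp only [Pi.smul_apply, smul_eq_mul, mul_left_comm _ a]
      rw [← Finset.mul_sum, hα ℓ' h h', mul_assoc]
  exact key _ hdxQ

end CollinearTangents

/-- Affine form of the trisecant lemma: a general secant of a parametrised variety of dimension
at most the ambient dimension minus two has no third intersection with it. -/
theorem exists_ne_zero_forall_collinear {k R : Type} {n N : ℕ} [Field k] [IsAlgClosed k]
    [CharZero k] [CommRing R] [IsDomain R] [Algebra k R] [Algebra.FiniteType k R]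
    (b : Basis (Fin n) R Ω[R⁄k]) (hn : n + 2 ≤ N) (f : Fin (N + 1) → R) (j₀ : Fin (N + 1))
    (hj₀ : f j₀ = 1) (hf : LinearIndependent k f)
    (hsep : ∀ x y : R →ₐ[k] k, (∀ l, x (f l) = y (f l)) → x = y) :
    ∃ D : R ⊗[k] R, D ≠ 0 ∧ ∀ (x z w : R →ₐ[k] k) (t : k), t ≠ 0 → t ≠ 1 →
      (∀ l, w (f l) = (1 - t) * x (f l) + t * z (f l)) →
      Algebra.TensorProduct.productMap x z D = 0 := by
  by_contra! hcon
  obtain ⟨K, _, _, x, z, w, t, ht0, ht1, hrel, hinj⟩ := exists_generic_collinear f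
    fun D hD => by
      obtain ⟨x, z, w, t, h0, h1, h2, h3⟩ := hcon D hD
      exact ⟨x, z, w, t, h0, h1, h2, h3⟩
  let u : (Fin (N + 1) → R) →ₗ[R] (Option (Fin n) → R) :=
    LinearMap.pi fun o => ∑ l, (o.elim (f l) fun i => b.partialDer i (f l)) • LinearMap.proj l
  have hu : ∀ ℓ, u ℓ = 0 → (∑ l, ℓ l * f l = 0) ∧ ∀ i, ∑ l, ℓ l * b.partialDer i (f l) = 0 := by
    intro ℓ h
    exact ⟨by simpa [u, mul_comm] using congrFun h none,
      fun i => by simpa [u, mul_comm] using congrFun h (some i)⟩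
  obtain ⟨l₁, l₂, hl, hu₁, hu₂⟩ := exists_pair_mem_ker (by simp; omega) u
  obtain ⟨i₀, i₁, hmin⟩ := exists_ne_zero_minor hl
  obtain ⟨z₀, hz₀⟩ := exists_algHom_ne_zero (k := k) (fun h => hmin h.eq_zero)
  let g : (Fin (N + 1) → R) → R := fun ℓ => ∑ l, z₀ (ℓ l) • f l
  have hD : ∀ j, b.partialDer j (g l₁) * g l₂ = b.partialDer j (g l₂) * g l₁ := by
    intro j
    obtain ⟨α, hα⟩ := mem_span_of_collinear b f j₀ hj₀ hf hsep x z w ht0 ht1 hrel hinj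
      (hl.ne_zero 0) (hu l₁ hu₁).1 (hu l₁ hu₁).2 j
    have h1 := hα l₁ (hu l₁ hu₁).1 (hu l₁ hu₁).2
    have h2 := hα l₂ (hu l₂ hu₂).1 (hu l₂ hu₂).2
    let d : (Fin (N + 1) → R) → R ⊗[k] R := fun ℓ => ∑ l, b.partialDer j (f l) ⊗ₜ[k] ℓ l
    let e : (Fin (N + 1) → R) → R ⊗[k] R := fun ℓ => ∑ l, f l ⊗ₜ[k] ℓ l
    have h3 : d l₁ * e l₂ = d l₂ * e l₁ := by
      apply hinj
      have hd : ∀ ℓ, Algebra.TensorProduct.productMap x z (d ℓ) =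
          ∑ l, z (ℓ l) * x (b.partialDer j (f l)) := fun ℓ => by simp [d, mul_comm]
      have he : ∀ ℓ, Algebra.TensorProduct.productMap x z (e ℓ) =
          ∑ l, z (ℓ l) * x (f l) := fun ℓ => by simp [e, mul_comm]
      rw [map_mul, map_mul, hd, hd, he, he, h1, h2]
      ring
    have h4 := congrArg (Algebra.TensorProduct.lift (AlgHom.id k R) ((Algebra.ofId k R).comp z₀)
        (fun _ _ => .all _ _)) h3
    simpa [d, e, g, Algebra.ofId_apply, Algebra.smul_def, mul_comm] using h4
  have hg : ∀ ℓ, g ℓ = 0 → ∀ l, z₀ (ℓ l) = 0 := fun ℓ h =>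
    Fintype.linearIndependent_iff.1 hf _ h
  simp only [map_sub, map_mul] at hz₀
  by_cases hg₂ : g l₂ = 0
  · simp [hg _ hg₂] at hz₀
  · obtain ⟨c, hc⟩ := b.exists_eq_smul_of_partialDer hg₂ hD
    have : ∀ l, z₀ (l₁ l) - c * z₀ (l₂ l) = 0 := by
      refine Fintype.linearIndependent_iff.1 hf _ ?_
      simp only [sub_smul, Finset.sum_sub_distrib, mul_smul, ← Finset.smul_sum]
      exact sub_eq_zero.2 hc
    rw [sub_eq_zero.1 (this i₀), sub_eq_zero.1 (this i₁)] at hz₀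
    exact hz₀ (by ring)

theorem Algebra.trdeg_eq_of_isAlgebraic {k A B : Type} [Field k] [CommRing A] [CommRing B]
    [IsDomain B] [Algebra k A] [Algebra k B] [Algebra A B] [IsScalarTower k A B]
    (hinj : Function.Injective (algebraMap A B)) [Algebra.IsAlgebraic A B] :
    Algebra.trdeg k A = Algebra.trdeg k B := by
  have : FaithfulSMul A B := (faithfulSMul_iff_algebraMap_injective A B).2 hinj
  have : IsDomain A := hinj.isDomain (algebraMap A B)
  rw [← trdeg_add_eq k A (A := B), trdeg_eq_zero (R := A), add_zero]

theorem ringKrullDim_eq_of_isIntegral {A B : Type} [CommRing A] [CommRing B] [IsDomain B]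
    [Algebra A B] (hinj : Function.Injective (algebraMap A B)) [Algebra.IsIntegral A B] :
    ringKrullDim B = ringKrullDim A := by
  have : IsDomain A := hinj.isDomain (algebraMap A B)
  apply le_antisymm
  · refine Order.krullDim_le_of_strictMono (PrimeSpectrum.comap (algebraMap A B)) ?_
    intro p q hpq
    exact Ideal.IsIntegral.comap_lt_comap (R := A) hpq
  · have key : ∀ n (l : LTSeries (PrimeSpectrum A)), l.length = n →
        ∃ l' : LTSeries (PrimeSpectrum B), l'.length = n ∧
          PrimeSpectrum.comap (algebraMap A B) l'.last = l.last := by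
      intro n
      induction n with
      | zero =>
        intro l hl
        obtain ⟨Q, -, hQ, hQ'⟩ := Ideal.exists_ideal_over_prime_of_isIntegral (R := A) (S := B)
          l.last.asIdeal ⊥ (by rw [Ideal.comap_bot_of_injective _ hinj]; exact bot_le)
        exact ⟨RelSeries.singleton _ ⟨Q, hQ⟩, rfl, PrimeSpectrum.ext hQ'⟩
      | succ n ih =>
        intro l hl
        obtain ⟨l', hl', hlast⟩ := ih l.eraseLast (by simp [hl])
        have hlt : l.eraseLast.last < l.last := l.eraseLast_last_rel_last (by omega)
        rw [← hlast] at hlt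
        obtain ⟨Q, hQ1, hQ, hQ'⟩ := Ideal.exists_ideal_over_prime_of_isIntegral (R := A) (S := B)
          l.last.asIdeal l'.last.asIdeal hlt.le
        have hQeq : PrimeSpectrum.comap (algebraMap A B) ⟨Q, hQ⟩ = l.last := PrimeSpectrum.ext hQ'
        have hlt' : l'.last < ⟨Q, hQ⟩ := by
          refine lt_of_le_of_ne hQ1 fun h => ?_
          rw [h, hQeq] at hlt
          exact lt_irrefl _ hlt
        exact ⟨l'.snoc ⟨Q, hQ⟩ hlt', by simp [hl'], by simpa using hQeq⟩
    refine iSup_le fun l => ?_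
    obtain ⟨l', hl', -⟩ := key _ l rfl
    rw [← hl']
    exact Order.LTSeries.length_le_krullDim l'

theorem exists_ringKrullDim_eq_trdeg_eq (k A : Type) [Field k] [CommRing A] [IsDomain A]
    [Algebra k A] [Algebra.FiniteType k A] :
    ∃ d : ℕ, ringKrullDim A = d ∧ Algebra.trdeg k A = d := by
  obtain ⟨s, g, hg, hgi⟩ := exists_integral_inj_algHom_of_fg k A
  let _ : Algebra (MvPolynomial (Fin s) k) A := g.toAlgebra
  have : IsScalarTower k (MvPolynomial (Fin s) k) A :=
    .of_algebraMap_eq fun c => (g.commutes c).symm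
  have : Algebra.IsIntegral (MvPolynomial (Fin s) k) A := ⟨hgi⟩
  refine ⟨s, ?_, ?_⟩
  · rw [ringKrullDim_eq_of_isIntegral (A := MvPolynomial (Fin s) k) (B := A) hg]
    simp
  · rw [← Algebra.trdeg_eq_of_isAlgebraic (k := k) (A := MvPolynomial (Fin s) k) (B := A) hg]
    simp

theorem Module.Basis.natCast_le_trdeg {k R : Type} {n : ℕ} [Field k] [CharZero k] [CommRing R]
    [IsDomain R] [Algebra k R] (b : Basis (Fin n) R Ω[R⁄k]) : (n : Cardinal) ≤ Algebra.trdeg k R := by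
  obtain ⟨s, hs⟩ := exists_isTranscendenceBasis k R
  by_contra! hlt
  rw [← hs.cardinalMk_eq_trdeg] at hlt
  have hfin : Finite s := Cardinal.lt_aleph0_iff_finite.1 (hlt.trans Cardinal.natCast_lt_aleph0)
  let _ := Fintype.ofFinite s
  rw [Cardinal.mk_fintype, Nat.cast_lt] at hlt
  have h1 : ¬ Function.Injective (Matrix.mulVecLin (R := FractionRing R)
      (Matrix.of fun (r : s) i => algebraMap R (FractionRing R) (b.partialDer i r))) := by
    intro h
    have := LinearMap.finrank_le_finrank_of_injective h
    simp only [finrank_fintype_fun_eq_card, Fintype.card_fin] at this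
    exact absurd this (not_le.2 hlt)
  rw [injective_iff_map_eq_zero] at h1
  push Not at h1
  obtain ⟨c, hc, hc0⟩ := h1
  refine hc0 (b.eq_zero_of_sum_partialDer_eq_zero (IsFractionRing.injective R (FractionRing R))
    (Algebra.adjoin k s) ?_ s rfl c fun r hr => ?_)
  · have := hs.isAlgebraic
    rwa [Subtype.range_coe] at this
  · have := congrFun hc ⟨r, hr⟩
    simpa [Matrix.mulVec, dotProduct, mul_comm] using this

theorem exists_basis_kaehlerDifferential_away (k A : Type) [Field k] [CommRing A] [IsDomain A]
    [Algebra k A] [Algebra.FiniteType k A] :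
    ∃ (h : A) (n : ℕ), h ≠ 0 ∧ Nonempty (Basis (Fin n) (Localization.Away h)
      Ω[Localization.Away h⁄k]) := by
  have : IsNoetherianRing A := Algebra.FiniteType.isNoetherianRing k A
  have : Module.FinitePresentation A Ω[A⁄k] := Module.finitePresentation_of_finite A _
  obtain ⟨n, b⟩ : ∃ n, Nonempty (Basis (Fin n) (FractionRing A)
      (LocalizedModule (nonZeroDivisors A) Ω[A⁄k])) := ⟨_, ⟨finBasis _ _⟩⟩
  obtain ⟨b⟩ := b
  obtain ⟨h, hh, b', -⟩ := Module.FinitePresentation.exists_basis_localizedModule_powers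
    (nonZeroDivisors A) (LocalizedModule.mkLinearMap _ _) (FractionRing A) b
  refine ⟨h, n, nonZeroDivisors.ne_zero hh, ⟨b'.map ?_⟩⟩
  exact (IsLocalizedModule.linearEquiv (Submonoid.powers h)
    (LocalizedModule.mkLinearMap (Submonoid.powers h) Ω[A⁄k])
    (KaehlerDifferential.map k k A (Localization.Away h))).extendScalarsOfIsLocalization
      (Submonoid.powers h) (Localization.Away h)

end

theorem MvPolynomial.IsHomogeneous.eval_smul {σ R : Type*} [CommSemiring R] {f : MvPolynomial σ R}
    {d : ℕ} (hf : f.IsHomogeneous d) (c : R) (v : σ → R) : eval (c • v) f = c ^ d * eval v f := by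
  rw [eval_eq, eval_eq, Finset.mul_sum]
  refine Finset.sum_congr rfl fun s hs => ?_
  simp only [Pi.smul_apply, smul_eq_mul, mul_pow, Finset.prod_mul_distrib, Finset.prod_pow_eq_pow_sum]
  rw [hf.degree_eq_sum_deg_support hs]
  ring

theorem MvPolynomial.eval_bind₁ {σ τ R : Type*} [CommSemiring R] (v : τ → R)
    (F : σ → MvPolynomial τ R) (g : MvPolynomial σ R) :
    eval v (bind₁ F g) = eval (fun i => eval v (F i)) g := by
  rw [← aeval_eq_eval, ← aeval_eq_eval]
  exact aeval_bind₁ v F g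

namespace PinchPaper

variable {k : Type} [Field k] {M N : ℕ}

theorem mk_smul_eq {v : Fin (N + 1) → k} (hv : v ≠ 0) {c : k} (hc : c ≠ 0) :
    (Projectivization.mk k (c • v) (smul_ne_zero hc hv) : Pr k N) = Projectivization.mk k v hv :=
  (Projectivization.mk_eq_mk_iff' k _ _ _ _).2 ⟨c, rfl⟩

theorem vanishes_mk_iff {f : MvPolynomial (Fin (N + 1)) k} {d : ℕ} (hf : f.IsHomogeneous d)
    {v : Fin (N + 1) → k} (hv : v ≠ 0) :
    Vanishes f (Projectivization.mk k v hv) ↔ eval v f = 0 := by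
  refine ⟨fun h => h v hv rfl, fun h w hw hwv => ?_⟩
  obtain ⟨c, rfl⟩ := (Projectivization.mk_eq_mk_iff' k _ _ _ _).1 hwv
  rw [hf.eval_smul, h, mul_zero]

theorem IsAlgSet.exists_homogeneous {Z : Set (Pr k N)} (hZ : IsAlgSet Z) :
    ∃ S : Set (MvPolynomial (Fin (N + 1)) k), (∀ f ∈ S, ∃ d, f.IsHomogeneous d) ∧
      ∀ v hv, Projectivization.mk k v hv ∈ Z ↔ ∀ f ∈ S, eval v f = 0 := by
  obtain ⟨S, hS, rfl⟩ := hZ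
  refine ⟨S, hS, fun v hv => forall₂_congr fun f hf => ?_⟩
  obtain ⟨d, hd⟩ := hS f hf
  exact vanishes_mk_iff hd hv

theorem isAlgSet_of_forall_mk_mem_iff [Infinite k] {Z : Set (Pr k N)}
    (S : Set (MvPolynomial (Fin (N + 1)) k))
    (hS : ∀ v hv, Projectivization.mk k v hv ∈ Z ↔ ∀ f ∈ S, eval v f = 0) : IsAlgSet Z := by
  refine ⟨{g | ∃ f ∈ S, ∃ d, g = homogeneousComponent d f}, ?_, ?_⟩
  · rintro _ ⟨f, -, d, rfl⟩
    exact ⟨d, homogeneousComponent_isHomogeneous d f⟩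
  · ext p
    induction p using Projectivization.ind with | h v hv =>
    constructor
    · rintro hp _ ⟨f, hf, d, rfl⟩
      rw [vanishes_mk_iff (homogeneousComponent_isHomogeneous d f)]
      let P : Polynomial k := ∑ e ∈ Finset.range (f.totalDegree + 1),
        Polynomial.monomial e (eval v (homogeneousComponent e f))
      have hP : P = 0 := by
        refine Polynomial.eq_zero_of_infinite_isRoot P ?_
        refine Set.Infinite.mono (s := {c : k | c ≠ 0}) ?_ ?_
        · intro c hc
          have h1 := (hS (c • v) (smul_ne_zero hc hv)).1 (by rwa [mk_smul_eq hv hc]) f hf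
          rw [← sum_homogeneousComponent f, map_sum] at h1
          simp only [Set.mem_ofPred_eq, Polynomial.IsRoot, P, Polynomial.eval_finsetSum,
            Polynomial.eval_monomial]
          rw [← h1]
          refine Finset.sum_congr rfl fun e _ => ?_
          rw [(homogeneousComponent_isHomogeneous e f).eval_smul, mul_comm]
        · exact (Set.finite_singleton (0 : k)).infinite_compl
      have h2 := congrArg (Polynomial.coeff · d) hP
      by_cases hd : d ∈ Finset.range (f.totalDegree + 1)
      · simpa [P, Polynomial.finsetSum_coeff, Polynomial.coeff_monomial, hd,
          -Finset.mem_range] using h2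
      · rw [homogeneousComponent_eq_zero _ _ (by simpa using hd), map_zero]
    · intro h
      rw [hS]
      intro f hf
      rw [← sum_homogeneousComponent f, map_sum]
      refine Finset.sum_eq_zero fun e _ => ?_
      exact (vanishes_mk_iff (homogeneousComponent_isHomogeneous e f) hv).1 (h _ ⟨f, hf, e, rfl⟩)

theorem isAlgSet_empty : IsAlgSet (∅ : Set (Pr k N)) := by
  refine ⟨{1}, by simpa using ⟨0, isHomogeneous_one _ _⟩, ?_⟩
  ext p
  induction p using Projectivization.ind with | h v hv =>
  simp [vanishes_mk_iff (isHomogeneous_one _ _) hv]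

theorem isAlgSet_setOf_vanishes {f : MvPolynomial (Fin (N + 1)) k} {d : ℕ}
    (hf : f.IsHomogeneous d) : IsAlgSet {p : Pr k N | Vanishes f p} :=
  ⟨{f}, by simpa using ⟨d, hf⟩, by simp⟩

theorem LocalRep.eval_ne_zero {X : Set (Pr k M)} {φ : Pr k M → Pr k N} {p : Pr k M}
    {F : Fin (N + 1) → MvPolynomial (Fin (M + 1)) k} (hF : LocalRep X φ p F)
    {v : Fin (M + 1) → k} (hv : v ≠ 0) (hvp : Projectivization.mk k v hv = p) :
    (fun i => eval v (F i)) ≠ 0 := by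
  obtain ⟨⟨d, hd⟩, hF0, -⟩ := hF
  obtain ⟨c, hc⟩ := Projectivization.exists_smul_eq_mk_rep k v hv
  intro h
  apply hF0
  funext i
  rw [← hvp, ← hc, Units.smul_def, (hd i).eval_smul, congrFun h i]
  simp

theorem isAlgSet_preimage [Infinite k] {X : Set (Pr k M)} {φ : Pr k M → Pr k N} {W : Set (Pr k N)}
    (hX : IsAlgSet X) (hφ : IsMorphismOn X φ) (hW : IsAlgSet W) :
    IsAlgSet {p | p ∈ X ∧ φ p ∈ W} := by
  obtain ⟨S, -, hS⟩ := hX.exists_homogeneous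
  obtain ⟨T, hTh, hT⟩ := hW.exists_homogeneous
  refine isAlgSet_of_forall_mk_mem_iff
    (S ∪ {f | ∃ q ∈ X, ∃ F, LocalRep X φ q F ∧ ∃ g ∈ T, ∃ j, f = bind₁ F g * F j}) fun v hv => ?_
  simp only [Set.mem_ofPred_eq, Set.mem_union, or_imp, forall_and, hS]
  refine and_congr_right fun hvX => ?_
  rw [← hS v hv] at hvX
  constructor
  · rintro h _ ⟨q, hq, F, hF, g, hg, j, rfl⟩
    by_cases hFv : (fun i => eval v (F i)) = 0
    · rw [map_mul, show eval v (F j) = 0 from congrFun hFv j, mul_zero]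
    · rw [hF.2.2 _ hvX v hv rfl hFv, hT] at h
      rw [map_mul, eval_bind₁, h g hg, zero_mul]
  · intro h
    obtain ⟨F, hF⟩ := hφ _ hvX
    have hFv := hF.eval_ne_zero hv rfl
    rw [hF.2.2 _ hvX v hv rfl hFv, hT]
    intro g hg
    obtain ⟨j, hj⟩ := Function.ne_iff.1 hFv
    have := h _ ⟨_, hvX, F, hF, g, hg, j, rfl⟩
    rw [map_mul, eval_bind₁] at this
    exact (mul_eq_zero.1 this).resolve_right hj

theorem IsVariety.image_irreducible [Infinite k] {X : Set (Pr k M)} {φ : Pr k M → Pr k N}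
    (hX : IsVariety X) (hφ : IsMorphismOn X φ) (himg : IsAlgSet (φ '' X)) :
    IsVariety (φ '' X) := by
  refine ⟨himg, hX.2.1.image φ, fun Z₁ Z₂ h₁ h₂ h => ?_⟩
  have := hX.2.2 _ _ (isAlgSet_preimage hX.1 hφ h₁) (isAlgSet_preimage hX.1 hφ h₂) fun p hp =>
    (h (Set.mem_image_of_mem φ hp)).imp (fun h => ⟨hp, h⟩) (fun h => ⟨hp, h⟩)
  refine this.imp (fun h => ?_) (fun h => ?_) <;>
  · rintro _ ⟨p, hp, rfl⟩
    exact (h hp).2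

end PinchPaper

attribute [local instance] MvPolynomial.gradedAlgebra in
/-- Points over which a family of homogeneous equations has no nontrivial solution are separated
by a polynomial from those over which it has one. -/
theorem exists_eval_ne_zero_of_forall_homogeneous {k σ τ : Type} [Field k] [IsAlgClosed k] [Finite σ]
    (T : Set (MvPolynomial σ (MvPolynomial τ k))) (hT : ∀ G ∈ T, ∃ d, G.IsHomogeneous d)
    (y₀ : τ → k) (hy₀ : ∀ v : σ → k, (∀ G ∈ T, eval v (map (eval y₀) G) = 0) → v = 0) :
    ∃ r : MvPolynomial τ k, eval y₀ r ≠ 0 ∧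
      ∀ y, ∀ v : σ → k, v ≠ 0 → (∀ G ∈ T, eval v (map (eval y) G) = 0) → eval y r = 0 := by
  classical
  let I : Ideal (MvPolynomial σ (MvPolynomial τ k)) := Ideal.span T
  let 𝔪 : Ideal (MvPolynomial τ k) := RingHom.ker (eval y₀)
  let e : MvPolynomial σ (MvPolynomial τ k) →+* MvPolynomial σ k := map (eval y₀)
  have hes : Function.Surjective e := map_surjective _ fun c => ⟨C c, by simp⟩
  have hI : I.IsHomogeneous (homogeneousSubmodule σ (MvPolynomial τ k)) :=
    Ideal.homogeneous_span _ _ fun G hG => by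
      obtain ⟨d, hd⟩ := hT G hG
      exact ⟨d, hd⟩
  have hvar : idealOfVars σ k ≤ (I.map e).radical := by
    rw [← vanishingIdeal_zeroLocus_eq_radical (K := k), idealOfVars, Ideal.span_le]
    rintro _ ⟨i, rfl⟩
    rw [SetLike.mem_coe, mem_vanishingIdeal_iff]
    intro v hv
    have : v = 0 := hy₀ v fun G hG => by
      simpa only [aeval_eq_eval] using hv (e G) (Ideal.mem_map_of_mem e (Ideal.subset_span hG))
    simp [this]
  obtain ⟨d, hd⟩ := Ideal.exists_pow_le_of_le_radical_of_fg hvar (idealOfVars_fg σ k)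
  let N : Submodule (MvPolynomial τ k) (MvPolynomial σ (MvPolynomial τ k) ⧸ I) :=
    Submodule.span _ ((fun s => Ideal.Quotient.mk I (monomial s 1)) '' {s : σ →₀ ℕ | s.degree = d})
  have hfin : {s : σ →₀ ℕ | s.degree = d}.Finite := (Finsupp.finite_of_degree_le d).subset fun s hs => le_of_eq hs
  have hN : N.FG := Submodule.fg_span (hfin.image _)
  have hle : N ≤ 𝔪 • N := by
    refine Submodule.span_le.2 ?_
    rintro _ ⟨s, hs, rfl⟩
    have h1 : monomial s (1 : k) ∈ I.map e :=
      hd ((monomial_mem_pow_idealOfVars_iff d s one_ne_zero).2 (le_of_eq hs.symm))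
    obtain ⟨P, hP, hPe⟩ := (Ideal.mem_map_iff_of_surjective e hes).1 h1
    have hPd := homogeneousComponent_mem_of_mem hI hP d
    set Q := monomial s 1 - homogeneousComponent d P with hQ
    have hQd : Q.IsHomogeneous d :=
      (isHomogeneous_monomial 1 hs).sub (homogeneousComponent_isHomogeneous d P)
    have hQ𝔪 : ∀ t, coeff t Q ∈ 𝔪 := fun t => by
      have := congrArg (coeff t) hPe
      simp only [e, coeff_map, coeff_monomial] at this
      simp only [𝔪, RingHom.mem_ker, hQ, coeff_sub, coeff_monomial, map_sub,
        coeff_homogeneousComponent]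
      rcases eq_or_ne s t with rfl | h2
      · rw [if_pos rfl] at this
        rw [if_pos rfl, if_pos (show Finsupp.degree s = d from hs), this, map_one, sub_self]
      · rw [if_neg h2] at this
        rw [if_neg h2, apply_ite (eval y₀), this, map_zero, ite_self, sub_self]
    have hmk : Ideal.Quotient.mk I (monomial s 1) = Ideal.Quotient.mk I Q := by
      rw [Ideal.Quotient.eq, hQ, sub_sub_cancel]
      exact hPd
    simp only [SetLike.mem_coe, hmk]
    rw [Q.as_sum, map_sum]
    refine Submodule.sum_mem _ fun t ht => ?_
    have : Ideal.Quotient.mk I (monomial t (coeff t Q)) =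
        coeff t Q • Ideal.Quotient.mk I (monomial t 1) := by
      rw [← Ideal.Quotient.mkₐ_eq_mk (MvPolynomial τ k), ← map_smul, smul_monomial, smul_eq_mul, mul_one]
    rw [this]
    refine Submodule.smul_mem_smul (hQ𝔪 t) (Submodule.subset_span ⟨t, ?_, rfl⟩)
    exact (hQd.degree_eq_sum_deg_support ht).symm
  obtain ⟨r, hr, hrN⟩ := Submodule.exists_sub_one_mem_and_smul_eq_zero_of_fg_of_le_smul 𝔪 N hN hle
  refine ⟨r, ?_, fun y v hv hy => ?_⟩
  · have : eval y₀ r - 1 = 0 := by simpa [𝔪, RingHom.mem_ker] using hr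
    rw [sub_eq_zero.1 this]
    exact one_ne_zero
  · obtain ⟨i, hi⟩ := Function.ne_iff.1 hv
    have h1 := hrN _ (Submodule.subset_span ⟨Finsupp.single i d, Finsupp.degree_single i d, rfl⟩)
    rw [← Ideal.Quotient.mkₐ_eq_mk (MvPolynomial τ k), ← map_smul, Ideal.Quotient.mkₐ_eq_mk,
      Ideal.Quotient.eq_zero_iff_mem] at h1
    have hIle : I ≤ RingHom.ker ((eval v).comp (map (eval y))) :=
      Ideal.span_le.2 fun G hG => hy G hG
    have h2 := hIle h1
    rw [RingHom.mem_ker] at h2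
    have hid : v i ^ d ≠ 0 := pow_ne_zero d hi
    simpa [smul_monomial, eval_monomial, hid, -pow_eq_zero_iff] using h2

namespace PinchPaper

variable {k : Type} [Field k] {M N : ℕ}

theorem isAlgSet_image [IsAlgClosed k] {X : Set (Pr k M)} {φ : Pr k M → Pr k N}
    (hX : IsAlgSet X) (hφ : IsMorphismOn X φ) : IsAlgSet (φ '' X) := by
  obtain ⟨S, hSh, hS⟩ := hX.exists_homogeneous
  let T : Set (MvPolynomial (Fin (M + 1)) (MvPolynomial (Fin (N + 1)) k)) :=
    {G | ∃ g ∈ S, G = map C g} ∪ {G | ∃ q ∈ X, ∃ F, LocalRep X φ q F ∧ ∃ i j,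
      G = C (MvPolynomial.X i) * map C (F j) - C (MvPolynomial.X j) * map C (F i)}
  have hT : ∀ G ∈ T, ∃ d, G.IsHomogeneous d := by
    rintro _ (⟨g, hg, rfl⟩ | ⟨q, hq, F, hF, i, j, rfl⟩)
    · obtain ⟨d, hd⟩ := hSh g hg
      exact ⟨d, hd.map _⟩
    · obtain ⟨d, hd⟩ := hF.1
      exact ⟨d, (((hd j).map _).C_mul _).sub (((hd i).map _).C_mul _)⟩
  have key : ∀ (y : Fin (N + 1) → k) (hy : y ≠ 0), Projectivization.mk k y hy ∈ φ '' X ↔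
      ∃ v : Fin (M + 1) → k, v ≠ 0 ∧ ∀ G ∈ T, eval v (map (eval y) G) = 0 := by
    intro y hy
    have hcC : ∀ g : MvPolynomial (Fin (M + 1)) k, map (eval y) (map C g) = g := fun g => by
      rw [MvPolynomial.map_map, show (eval y).comp C = RingHom.id k from RingHom.ext fun c => by simp, MvPolynomial.map_id]
    have hsys : ∀ v : Fin (M + 1) → k, (∀ G ∈ T, eval v (map (eval y) G) = 0) ↔
        (∀ g ∈ S, eval v g = 0) ∧ ∀ q ∈ X, ∀ F, LocalRep X φ q F → ∀ i j,
          y i * eval v (F j) - y j * eval v (F i) = 0 := by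
      intro v
      constructor
      · intro h
        refine ⟨fun g hg => ?_, fun q hq F hF i j => ?_⟩
        · simpa only [hcC] using h _ (Or.inl ⟨g, hg, rfl⟩)
        · simpa only [hcC, map_sub, map_mul, map_C, eval_X, eval_C] using
            h _ (Or.inr ⟨q, hq, F, hF, i, j, rfl⟩)
      · rintro ⟨h1, h2⟩ _ (⟨g, hg, rfl⟩ | ⟨q, hq, F, hF, i, j, rfl⟩)
        · simpa only [hcC] using h1 g hg
        · simpa only [hcC, map_sub, map_mul, map_C, eval_X, eval_C] using h2 q hq F hF i j
    constructor
    · rintro ⟨p, hp, hpy⟩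
      induction p using Projectivization.ind with | h v hv =>
      refine ⟨v, hv, (hsys v).2 ⟨(hS v hv).1 hp, fun q hq F hF i j => ?_⟩⟩
      by_cases hFv : (fun i => eval v (F i)) = 0
      · rw [show eval v (F i) = 0 from congrFun hFv i, show eval v (F j) = 0 from congrFun hFv j]
        ring
      · rw [hF.2.2 _ hp v hv rfl hFv] at hpy
        obtain ⟨c, hc⟩ := (Projectivization.mk_eq_mk_iff' k _ _ _ _).1 hpy
        have h1 := congrFun hc i
        have h2 := congrFun hc j
        simp only [Pi.smul_apply, smul_eq_mul] at h1 h2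
        rw [← h1, ← h2]
        ring
    · rintro ⟨v, hv, h⟩
      obtain ⟨h1, h2⟩ := (hsys v).1 h
      have hp := (hS v hv).2 h1
      refine ⟨_, hp, ?_⟩
      obtain ⟨F, hF⟩ := hφ _ hp
      have hFv := hF.eval_ne_zero hv rfl
      rw [hF.2.2 _ hp v hv rfl hFv, Projectivization.mk_eq_mk_iff']
      obtain ⟨j, hj⟩ := Function.ne_iff.1 hy
      refine ⟨eval v (F j) / y j, ?_⟩
      funext i
      have := h2 _ hp F hF i j
      simp only [Pi.smul_apply, smul_eq_mul, Pi.zero_apply] at hj ⊢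
      field_simp
      linear_combination this
  refine isAlgSet_of_forall_mk_mem_iff
    {r | ∀ y, ∀ v : Fin (M + 1) → k, v ≠ 0 → (∀ G ∈ T, eval v (map (eval y) G) = 0) →
      eval y r = 0} fun y hy => ?_
  rw [key]
  refine ⟨fun ⟨v, hv, h⟩ r hr => hr y v hv h, fun h => ?_⟩
  by_contra! hne
  obtain ⟨r, hr, hr'⟩ := exists_eval_ne_zero_of_forall_homogeneous T hT y fun v hv => by
    by_contra hv0
    obtain ⟨G, hG, hG'⟩ := hne v hv0
    exact hG' (hv G hG)
  exact hr (h r hr')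

end PinchPaper

theorem MvPolynomial.exists_isHomogeneous_dehomogenize {σ R : Type*} [CommRing R] (i : σ)
    (f : MvPolynomial σ R) :
    ∃ (g : MvPolynomial σ R) (d : ℕ), g.IsHomogeneous d ∧ (∀ v : σ → R, v i = 1 → eval v g = eval v f) ∧
      g - f ∈ Ideal.span {(X i - 1 : MvPolynomial σ R)} := by
  have hmem : (∑ d ∈ Finset.range (f.totalDegree + 1),
      X i ^ (f.totalDegree - d) * homogeneousComponent d f) - f ∈
        Ideal.span {(X i - 1 : MvPolynomial σ R)} := by
    rw [← Ideal.Quotient.eq]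
    have hX : Ideal.Quotient.mk (Ideal.span {(X i - 1 : MvPolynomial σ R)}) (X i) = 1 := by
      rw [← map_one (Ideal.Quotient.mk _), Ideal.Quotient.eq]
      exact Ideal.mem_span_singleton_self _
    conv_rhs => rw [← sum_homogeneousComponent f]
    simp [map_sum, hX]
  refine ⟨_, f.totalDegree, ?_, fun v hv => ?_, hmem⟩
  · refine IsHomogeneous.sum _ _ _ fun d hd => ?_
    have hd' : d ≤ f.totalDegree := by simpa [Nat.lt_succ_iff] using hd
    simpa [hd'] using (isHomogeneous_X_pow i (f.totalDegree - d)).mul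
      (homogeneousComponent_isHomogeneous d f)
  · rw [← sub_eq_zero, ← map_sub]
    obtain ⟨c, hc⟩ := Ideal.mem_span_singleton.1 hmem
    rw [hc]
    simp [hv]

namespace PinchPaper

variable {k : Type} [Field k] {M N : ℕ}

/-- The affine cone points of `Z` in the standard chart where the `i`-th coordinate is `1`. -/
def affChart (Z : Set (Pr k N)) (i : Fin (N + 1)) : Set (Fin (N + 1) → k) :=
  {v | v i = 1 ∧ ∃ hv, Projectivization.mk k v hv ∈ Z}

/-- The ideal of the `i`-th affine chart of `Z`. -/
def chartIdeal (Z : Set (Pr k N)) (i : Fin (N + 1)) : Ideal (MvPolynomial (Fin (N + 1)) k) :=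
  MvPolynomial.vanishingIdeal k (affChart Z i)

/-- The coordinate ring of the `i`-th affine chart of `Z`. -/
abbrev CoordRing (Z : Set (Pr k N)) (i : Fin (N + 1)) : Type :=
  MvPolynomial (Fin (N + 1)) k ⧸ chartIdeal Z i

theorem mem_chartIdeal {Z : Set (Pr k N)} {i : Fin (N + 1)} {f : MvPolynomial (Fin (N + 1)) k} :
    f ∈ chartIdeal Z i ↔ ∀ v ∈ affChart Z i, eval v f = 0 := by
  simp only [chartIdeal, mem_vanishingIdeal_iff, aeval_eq_eval]

theorem ne_zero_of_apply_eq_one {i : Fin (N + 1)} {v : Fin (N + 1) → k} (hv : v i = 1) : v ≠ 0 :=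
  fun h => by simp [h] at hv

theorem mem_affChart {Z : Set (Pr k N)} {i : Fin (N + 1)} {v : Fin (N + 1) → k} (hv : v i = 1) :
    v ∈ affChart Z i ↔ Projectivization.mk k v (ne_zero_of_apply_eq_one hv) ∈ Z :=
  ⟨fun h => h.2.2, fun h => ⟨hv, _, h⟩⟩

theorem exists_mk_eq_of_apply_ne_zero {i : Fin (N + 1)} {v : Fin (N + 1) → k} (hv : v ≠ 0)
    (hi : v i ≠ 0) : ∃ (w : Fin (N + 1) → k) (hw : w i = 1),
      Projectivization.mk k w (ne_zero_of_apply_eq_one hw) = Projectivization.mk k v hv :=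
  ⟨(v i)⁻¹ • v, by simp [hi], mk_smul_eq hv (inv_ne_zero hi)⟩

theorem exists_affChart_nonempty {Z : Set (Pr k N)} (hZ : Z.Nonempty) :
    ∃ i, (affChart Z i).Nonempty := by
  obtain ⟨p, hp⟩ := hZ
  induction p using Projectivization.ind with | h v hv =>
  obtain ⟨i, hi⟩ := Function.ne_iff.1 hv
  obtain ⟨w, hw, hwv⟩ := exists_mk_eq_of_apply_ne_zero hv hi
  exact ⟨i, w, (mem_affChart hw).2 (hwv ▸ hp)⟩

theorem IsAlgSet.affChart_eq_zeroLocus {Z : Set (Pr k N)} (hZ : IsAlgSet Z) (i : Fin (N + 1)) :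
    affChart Z i = zeroLocus k (chartIdeal Z i) := by
  refine le_antisymm (zeroLocus_vanishingIdeal_le _) fun v hv => ?_
  obtain ⟨S, hSh, hS⟩ := hZ.exists_homogeneous
  simp only [mem_zeroLocus_iff, aeval_eq_eval] at hv
  have hvi : v i = 1 := by
    have := hv (X i - 1) (mem_chartIdeal.2 fun w hw => by simp [hw.1])
    simpa [sub_eq_zero] using this
  rw [mem_affChart hvi, hS]
  exact fun f hf => hv f (mem_chartIdeal.2 fun w hw => (hS w _).1 hw.2.2 f hf)

theorem IsVariety.subset_of_forall_mem_affChart [Infinite k] {Z W : Set (Pr k N)} (hZ : IsVariety Z)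
    {i : Fin (N + 1)} (hi : (affChart Z i).Nonempty) (hW : IsAlgSet W)
    (h : affChart Z i ⊆ affChart W i) : Z ⊆ W := by
  have hX := isHomogeneous_X k i
  refine (hZ.2.2 _ W (isAlgSet_setOf_vanishes hX) hW fun p hp => ?_).resolve_left fun h' => ?_
  · induction p using Projectivization.ind with | h v hv =>
    by_cases hvi : v i = 0
    · exact Or.inl ((vanishes_mk_iff hX hv).2 (by simpa using hvi))
    · obtain ⟨w, hw, hwv⟩ := exists_mk_eq_of_apply_ne_zero hv hvi
      rw [← hwv] at hp ⊢
      exact Or.inr ((mem_affChart hw).1 (h ((mem_affChart hw).2 hp)))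
  · obtain ⟨v, hv, hv0, hvZ⟩ := hi
    have := (vanishes_mk_iff hX hv0).1 (h' hvZ)
    rw [eval_X, hv] at this
    exact one_ne_zero this

theorem IsVariety.forall_eval_eq_zero [Infinite k] {Z : Set (Pr k N)} (hZ : IsVariety Z)
    {i : Fin (N + 1)} (hi : (affChart Z i).Nonempty) {g : MvPolynomial (Fin (N + 1)) k} {d : ℕ}
    (hg : g.IsHomogeneous d) (h : g ∈ chartIdeal Z i) {v : Fin (N + 1) → k} (hv : v ≠ 0)
    (hvZ : Projectivization.mk k v hv ∈ Z) : eval v g = 0 := by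
  refine (vanishes_mk_iff hg hv).1
    (hZ.subset_of_forall_mem_affChart hi (isAlgSet_setOf_vanishes hg) (fun w hw => ?_) hvZ)
  exact ⟨hw.1, hw.2.1, (vanishes_mk_iff hg _).2 (mem_chartIdeal.1 h w hw)⟩

theorem IsVariety.isPrime_chartIdeal [Infinite k] {Z : Set (Pr k N)} (hZ : IsVariety Z)
    {i : Fin (N + 1)} (hi : (affChart Z i).Nonempty) : (chartIdeal Z i).IsPrime := by
  refine ⟨fun h => ?_, fun {f g} hfg => ?_⟩
  · obtain ⟨v, hv⟩ := hi
    have := mem_chartIdeal.1 ((Ideal.eq_top_iff_one _).1 h) v hv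
    simp at this
  · obtain ⟨f', d, hf', hff', -⟩ := f.exists_isHomogeneous_dehomogenize i
    obtain ⟨g', e, hg', hgg', -⟩ := g.exists_isHomogeneous_dehomogenize i
    have hprod : f' * g' ∈ chartIdeal Z i := mem_chartIdeal.2 fun v hv => by
      rw [map_mul, hff' v hv.1, hgg' v hv.1, ← map_mul]
      exact mem_chartIdeal.1 hfg v hv
    refine (hZ.2.2 _ _ (isAlgSet_setOf_vanishes hf') (isAlgSet_setOf_vanishes hg')
      fun p hp => ?_).imp (fun h => ?_) (fun h => ?_)
    · induction p using Projectivization.ind with | h v hv =>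
      have := hZ.forall_eval_eq_zero hi (hf'.mul hg') hprod hv hp
      rw [map_mul, mul_eq_zero] at this
      exact this.imp (vanishes_mk_iff hf' hv).2 (vanishes_mk_iff hg' hv).2
    · exact mem_chartIdeal.2 fun v hv => by
        rw [← hff' v hv.1]
        exact (vanishes_mk_iff hf' hv.2.1).1 (h hv.2.2)
    · exact mem_chartIdeal.2 fun v hv => by
        rw [← hgg' v hv.1]
        exact (vanishes_mk_iff hg' hv.2.1).1 (h hv.2.2)

theorem IsVariety.subset_iff_chartIdeal_le [Infinite k] {Z W : Set (Pr k N)} (hZ : IsVariety Z)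
    {i : Fin (N + 1)} (hi : (affChart Z i).Nonempty) (hW : IsAlgSet W) :
    Z ⊆ W ↔ chartIdeal W i ≤ chartIdeal Z i := by
  constructor
  · exact fun h => vanishingIdeal_anti_mono fun v hv => ⟨hv.1, hv.2.1, h hv.2.2⟩
  · intro h
    refine hZ.subset_of_forall_mem_affChart hi hW ?_
    rw [hZ.1.affChart_eq_zeroLocus, hW.affChart_eq_zeroLocus]
    exact zeroLocus_anti_mono h

end PinchPaper

namespace PinchPaper

variable {k : Type} [Field k] {M N : ℕ}

theorem exists_isVariety_chartIdeal_eq [IsAlgClosed k] {i : Fin (N + 1)}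
    (P : Ideal (MvPolynomial (Fin (N + 1)) k)) [hP : P.IsPrime]
    (hi : (X i - 1 : MvPolynomial (Fin (N + 1)) k) ∈ P) :
    ∃ W : Set (Pr k N), IsVariety W ∧ (affChart W i).Nonempty ∧ chartIdeal W i = P := by
  let W : Set (Pr k N) := {p | ∀ g ∈ {g | g ∈ P ∧ ∃ d, g.IsHomogeneous d}, Vanishes g p}
  have hW : IsAlgSet W := ⟨_, fun g hg => hg.2, rfl⟩
  have hmk : ∀ v hv, Projectivization.mk k v hv ∈ W ↔
      ∀ g ∈ P, (∃ d, g.IsHomogeneous d) → eval v g = 0 := fun v hv =>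
    ⟨fun h g hg ⟨d, hd⟩ => (vanishes_mk_iff hd hv).1 (h g ⟨hg, d, hd⟩),
      fun h g ⟨hg, d, hd⟩ => (vanishes_mk_iff hd hv).2 (h g hg ⟨d, hd⟩)⟩
  have hchart : affChart W i = zeroLocus k P := by
    ext v
    simp only [mem_zeroLocus_iff, aeval_eq_eval]
    constructor
    · rintro ⟨hvi, hv, hvW⟩ f hf
      obtain ⟨g, d, hg, hgf, hgP⟩ := f.exists_isHomogeneous_dehomogenize i
      rw [← hgf v hvi]
      refine (hmk v hv).1 hvW g ?_ ⟨d, hg⟩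
      have : g - f ∈ P := (Ideal.span_singleton_le_iff_mem _).2 hi hgP
      simpa using add_mem this hf
    · intro h
      have hvi : v i = 1 := by simpa [sub_eq_zero] using h _ hi
      rw [mem_affChart hvi, hmk]
      exact fun g hg _ => h g hg
  have hideal : chartIdeal W i = P := by
    rw [chartIdeal, hchart, IsPrime.vanishingIdeal_zeroLocus]
  have hne : (affChart W i).Nonempty := by
    by_contra h
    rw [Set.not_nonempty_iff_eq_empty] at h
    rw [chartIdeal, h, vanishingIdeal_empty] at hideal
    exact hP.ne_top hideal.symm
  refine ⟨W, ⟨hW, ?_, fun Z₁ Z₂ h₁ h₂ h => ?_⟩, hne, hideal⟩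
  · obtain ⟨v, hv⟩ := hne
    exact ⟨_, hv.2.2⟩
  · have hsub : ∀ Z : Set (Pr k N), IsAlgSet Z → affChart W i ⊆ affChart Z i → W ⊆ Z := by
      intro Z hZ hWZ p hp
      induction p using Projectivization.ind with | h v hv =>
      obtain ⟨S, hSh, hS⟩ := hZ.exists_homogeneous
      refine (hS v hv).2 fun g hg => (hmk v hv).1 hp g ?_ (hSh g hg)
      rw [← hideal, mem_chartIdeal]
      exact fun w hw => (hS w _).1 (hWZ hw).2.2 g hg
    by_contra! hne
    obtain ⟨v, hv, hv'⟩ := Set.not_subset.1 (mt (hsub Z₁ h₁) hne.1)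
    obtain ⟨w, hw, hw'⟩ := Set.not_subset.1 (mt (hsub Z₂ h₂) hne.2)
    obtain ⟨S₁, -, hS₁⟩ := h₁.exists_homogeneous
    obtain ⟨S₂, -, hS₂⟩ := h₂.exists_homogeneous
    rw [mem_affChart hv.1, hS₁] at hv'
    rw [mem_affChart hw.1, hS₂] at hw'
    push Not at hv' hw'
    obtain ⟨f, hf, hfv⟩ := hv'
    obtain ⟨g, hg, hgw⟩ := hw'
    have hfg : f * g ∈ P := by
      rw [← hideal, mem_chartIdeal]
      intro u hu
      rw [map_mul, mul_eq_zero]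
      exact (h hu.2.2).imp (fun h => (hS₁ _ _).1 h f hf) fun h => (hS₂ _ _).1 h g hg
    rw [hchart, mem_zeroLocus_iff] at hv hw
    rcases hP.mem_or_mem hfg with h | h
    · exact hfv (hv f h)
    · exact hgw (hw g h)

theorem sub_one_mem_chartIdeal (Z : Set (Pr k N)) (i : Fin (N + 1)) :
    (X i - 1 : MvPolynomial (Fin (N + 1)) k) ∈ chartIdeal Z i :=
  mem_chartIdeal.2 fun v hv => by simp [hv.1]

theorem IsVariety.ringKrullDim_coordRing_le [IsAlgClosed k] {Z : Set (Pr k N)} (hZ : IsVariety Z)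
    (i : Fin (N + 1)) :
    ringKrullDim (CoordRing Z i) ≤ Order.krullDim {W : Set (Pr k N) // IsVariety W ∧ W ⊆ Z} := by
  have h : ∀ P : PrimeSpectrum (CoordRing Z i), ∃ W : Set (Pr k N), IsVariety W ∧
      (affChart W i).Nonempty ∧ chartIdeal W i = P.asIdeal.comap (Ideal.Quotient.mk _) := fun P =>
    exists_isVariety_chartIdeal_eq _ (by
      rw [Ideal.mem_comap, Ideal.Quotient.eq_zero_iff_mem.2 (sub_one_mem_chartIdeal Z i)]
      exact zero_mem _)
  choose W hW hne hWP using h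
  have hWZ : ∀ P, W P ⊆ Z := fun P => by
    rw [(hW P).subset_iff_chartIdeal_le (hne P) hZ.1, hWP]
    exact fun f hf => by
      rw [Ideal.mem_comap, Ideal.Quotient.eq_zero_iff_mem.2 hf]
      exact zero_mem _
  have hle : ∀ P Q, W P ⊆ W Q ↔ Q ≤ P := fun P Q => by
    rw [(hW P).subset_iff_chartIdeal_le (hne P) (hW Q).1, hWP, hWP,
      Ideal.comap_le_comap_iff_of_surjective _ Ideal.Quotient.mk_surjective,
      PrimeSpectrum.asIdeal_le_asIdeal]
  rw [ringKrullDim, ← Order.krullDim_orderDual]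
  refine Order.krullDim_le_of_strictMono
    (fun P => ⟨W (OrderDual.ofDual P), hW _, hWZ _⟩) fun P Q hPQ => ?_
  rw [lt_iff_le_not_ge] at hPQ ⊢
  exact ⟨(hle _ _).2 hPQ.1, fun h => hPQ.2 ((hle _ _).1 h)⟩

theorem IsVariety.exists_length_le_ringKrullDim [Infinite k] {Z : Set (Pr k N)} (hZ : IsVariety Z)
    (l : LTSeries {W : Set (Pr k N) // IsVariety W ∧ W ⊆ Z}) :
    ∃ j, (affChart Z j).Nonempty ∧ (l.length : WithBot ℕ∞) ≤ ringKrullDim (CoordRing Z j) := by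
  obtain ⟨j, hj⟩ := exists_affChart_nonempty l.head.2.1.2.1
  have hmono : ∀ {W W' : Set (Pr k N)}, W ⊆ W' → affChart W j ⊆ affChart W' j :=
    fun h v hv => ⟨hv.1, hv.2.1, h hv.2.2⟩
  have hne : ∀ m, (affChart (l m).1 j).Nonempty := fun m =>
    hj.mono (hmono (l.head_le m))
  refine ⟨j, hj.mono (hmono l.head.2.2), ?_⟩
  have hle : ∀ m, chartIdeal Z j ≤ chartIdeal (l m).1 j := fun m =>
    ((l m).2.1.subset_iff_chartIdeal_le (hne m) hZ.1).1 (l m).2.2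
  have hcomap : ∀ m, ((chartIdeal (l m).1 j).map (Ideal.Quotient.mk (chartIdeal Z j))).comap
      (Ideal.Quotient.mk (chartIdeal Z j)) = chartIdeal (l m).1 j := fun m => by
    rw [Ideal.comap_map_of_surjective _ Ideal.Quotient.mk_surjective, ← RingHom.ker_eq_comap_bot,
      Ideal.mk_ker, sup_eq_left]
    exact hle m
  let P : Fin (l.length + 1) → (PrimeSpectrum (CoordRing Z j))ᵒᵈ := fun m =>
    OrderDual.toDual ⟨(chartIdeal (l m).1 j).map (Ideal.Quotient.mk (chartIdeal Z j)), by
      have := (l m).2.1.isPrime_chartIdeal (hne m)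
      refine Ideal.map_isPrime_of_surjective Ideal.Quotient.mk_surjective ?_
      rw [Ideal.mk_ker]
      exact hle m⟩
  have hP : ∀ m m', P m ≤ P m' ↔ l m ≤ l m' := fun m m' => by
    change Ideal.map _ _ ≤ Ideal.map _ _ ↔ (l m).1 ⊆ (l m').1
    rw [(l m).2.1.subset_iff_chartIdeal_le (hne m) (l m').2.1.1, Ideal.map_le_iff_le_comap, hcomap]
  have hPs : StrictMono P := fun m m' h => by
    have := l.strictMono h
    rw [lt_iff_le_not_ge] at this ⊢
    rwa [hP, hP]
  rw [ringKrullDim, ← Order.krullDim_orderDual]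
  exact Order.LTSeries.length_le_krullDim (LTSeries.mk l.length P hPs)

end PinchPaper

theorem Localization.Away.exists_algHom {k A : Type*} [Field k] [CommRing A] [Algebra k A] {h : A}
    (χ : A →ₐ[k] k) (hχ : χ h ≠ 0) :
    ∃ x : Localization.Away h →ₐ[k] k, ∀ a, x (algebraMap A _ a) = χ a := by
  have hu : ∀ y : Submonoid.powers h, IsUnit (χ y) := by
    rintro ⟨_, n, rfl⟩
    simpa using (hχ.isUnit).pow n
  exact ⟨IsLocalization.liftAlgHom (M := .powers h) (f := χ) hu, fun a =>
    IsLocalization.lift_eq (M := .powers h) (g := (χ : A →+* k)) hu a⟩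

theorem Localization.Away.algHom_ext' {k A : Type*} [Field k] [CommRing A] [Algebra k A] {h : A}
    {x y : Localization.Away h →ₐ[k] k}
    (hxy : ∀ a : A, x (algebraMap A _ a) = y (algebraMap A _ a)) : x = y := by
  have : (x : Localization.Away h →+* k) = y :=
    IsLocalization.ringHom_ext (.powers h) (RingHom.ext hxy)
  exact AlgHom.ext fun a => RingHom.congr_fun this a

theorem Localization.Away.algebraMap_injective {A : Type*} [CommRing A] [IsDomain A] {h : A}
    (hh : h ≠ 0) : Function.Injective (algebraMap A (Localization.Away h)) :=
  IsLocalization.injective _ (powers_le_nonZeroDivisors_of_noZeroDivisors hh)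

theorem Localization.Away.finiteType {k A : Type*} [Field k] [CommRing A] [Algebra k A]
    [Algebra.FiniteType k A] (h : A) : Algebra.FiniteType k (Localization.Away h) :=
  have : Algebra.FiniteType A (Localization.Away h) :=
    IsLocalization.finiteType_of_monoid_fg (.powers h) _
  .trans (S := A) inferInstance inferInstance

theorem Localization.Away.trdeg_eq {k A : Type} [Field k] [CommRing A] [IsDomain A] [Algebra k A]
    {h : A} (hh : h ≠ 0) : Algebra.trdeg k (Localization.Away h) = Algebra.trdeg k A := by
  have := Localization.Away.isDomain hh
  have : Algebra.IsAlgebraic A (Localization.Away h) :=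
    IsLocalization.isAlgebraic _ (.powers h)
  exact (Algebra.trdeg_eq_of_isAlgebraic (Localization.Away.algebraMap_injective hh)).symm

namespace PinchPaper

variable {k : Type} [Field k] {M N : ℕ}

/-- `R`, with the functions `ξ` and `f`, is the coordinate ring of a nonempty affine open subset of
`X \ Z` on which `ξ` are the homogeneous coordinates of the points and `f` those of their images
under `φ`. -/
structure IsAffModel (X : Set (Pr k M)) (φ : Pr k M → Pr k N) (Z : Set (Pr k M))
    (i : Fin (M + 1)) (j : Fin (N + 1)) {R : Type} [CommRing R] [Algebra k R]
    (ξ : Fin (M + 1) → R) (f : Fin (N + 1) → R) : Prop where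
  source_one : ξ i = 1
  target_one : f j = 1
  ext (x y : R →ₐ[k] k) (h : ∀ l, x (ξ l) = y (ξ l)) : x = y
  mem (x : R →ₐ[k] k) (hv) : Projectivization.mk k (fun l => x (ξ l)) hv ∈ X
  notMem (x : R →ₐ[k] k) (hv) : Projectivization.mk k (fun l => x (ξ l)) hv ∉ Z
  map (x : R →ₐ[k] k) (hv) (hw) :
    φ (Projectivization.mk k (fun l => x (ξ l)) hv) = Projectivization.mk k (fun l => x (f l)) hw
  dense (r : R) (hr : r ≠ 0) : ∃ Z', IsAlgSet Z' ∧ ¬ X ⊆ Z' ∧ ∀ p ∈ X, p ∉ Z' →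
    ∃ x : R →ₐ[k] k, x r ≠ 0 ∧ ∀ hv, Projectivization.mk k (fun l => x (ξ l)) hv = p

theorem IsAffModel.localize {X : Set (Pr k M)} {φ : Pr k M → Pr k N} {Z : Set (Pr k M)}
    {i : Fin (M + 1)} {j : Fin (N + 1)} {R : Type} [CommRing R] [IsDomain R] [Algebra k R]
    {ξ : Fin (M + 1) → R} {f : Fin (N + 1) → R} (H : IsAffModel X φ Z i j ξ f) {h : R} (hh : h ≠ 0) :
    IsAffModel X φ Z i j (fun l => algebraMap R (Localization.Away h) (ξ l))
      (fun l => algebraMap R (Localization.Away h) (f l)) where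
  source_one := by rw [H.source_one, map_one]
  target_one := by rw [H.target_one, map_one]
  ext x y hxy := Localization.Away.algHom_ext' fun a =>
    AlgHom.congr_fun (H.ext (x.comp (IsScalarTower.toAlgHom k R _))
      (y.comp (IsScalarTower.toAlgHom k R _)) hxy) a
  mem x hv := H.mem (x.comp (IsScalarTower.toAlgHom k R _)) hv
  notMem x hv := H.notMem (x.comp (IsScalarTower.toAlgHom k R _)) hv
  map x hv hw := H.map (x.comp (IsScalarTower.toAlgHom k R _)) hv hw
  dense r hr := by
    obtain ⟨⟨a, s, n, rfl⟩, ha⟩ := IsLocalization.surj (.powers h) r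
    simp only at ha
    have ha0 : a ≠ 0 := by
      rintro rfl
      have := Localization.Away.isDomain hh
      rw [map_zero] at ha
      refine mul_ne_zero hr ?_ ha
      rw [map_ne_zero_iff _ (Localization.Away.algebraMap_injective hh)]
      exact pow_ne_zero n hh
    obtain ⟨Z', hZ', hXZ', hp⟩ := H.dense (a * h) (mul_ne_zero ha0 hh)
    refine ⟨Z', hZ', hXZ', fun p hpX hpZ' => ?_⟩
    obtain ⟨χ, hχ, hχp⟩ := hp p hpX hpZ'
    rw [map_mul] at hχ
    obtain ⟨x, hx⟩ := Localization.Away.exists_algHom χ (right_ne_zero_of_mul hχ)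
    refine ⟨x, fun h0 => left_ne_zero_of_mul hχ ?_, ?_⟩
    · rw [← hx, ← ha, map_mul, h0, zero_mul]
    · simpa only [hx] using hχp

theorem exists_isAffModel [Infinite k] {X : Set (Pr k M)} {φ : Pr k M → Pr k N}
    (hX : IsVariety X) (hφ : IsMorphismOn X φ) {Z : Set (Pr k M)} (hZ : IsAlgSet Z) (hXZ : ¬ X ⊆ Z)
    {i : Fin (M + 1)} (hi : (affChart X i).Nonempty) {j : Fin (N + 1)}
    (hj : (affChart (φ '' X) j).Nonempty) :
    ∃ (R : Type) (_ : CommRing R) (_ : IsDomain R) (_ : Algebra k R) (_ : Algebra.FiniteType k R)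
      (ξ : Fin (M + 1) → R) (f : Fin (N + 1) → R), IsAffModel X φ Z i j ξ f ∧
      Algebra.trdeg k R = Algebra.trdeg k (CoordRing X i) := by
  have hprime := hX.isPrime_chartIdeal hi
  obtain ⟨p, hp, hpZ⟩ := Set.not_subset.1 hXZ
  induction p using Projectivization.ind with | h u hu =>
  obtain ⟨S, hSh, hS⟩ := hZ.exists_homogeneous
  obtain ⟨g, hg, hgu⟩ : ∃ g ∈ S, eval u g ≠ 0 := by simpa [hS] using hpZ
  obtain ⟨dg, hdg⟩ := hSh g hg
  obtain ⟨y, hyj, hy, q, hq, hqy⟩ := hj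
  obtain ⟨F, hF⟩ := hφ q hq
  have hFj : eval q.rep (F j) ≠ 0 := by
    intro h0
    have h1 := hF.2.2 q hq q.rep q.rep_nonzero q.mk_rep hF.2.1
    rw [hqy, Projectivization.mk_eq_mk_iff'] at h1
    obtain ⟨c, hc⟩ := h1
    have := congrFun hc j
    simp only [Pi.smul_apply, h0, smul_zero, hyj] at this
    exact zero_ne_one this
  obtain ⟨dF, hdF⟩ := hF.1
  have hgI : g ∉ chartIdeal X i := fun h => hgu (hX.forall_eval_eq_zero hi hdg h hu hp)
  have hFI : F j ∉ chartIdeal X i := fun h =>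
    hFj (hX.forall_eval_eq_zero hi (hdF j) h q.rep_nonzero (q.mk_rep.symm ▸ hq))
  have hGI : F j * g ∉ chartIdeal X i := fun h => (hprime.mem_or_mem h).elim hFI hgI
  let A := CoordRing X i
  have : IsDomain A := Ideal.Quotient.isDomain _
  let π : MvPolynomial (Fin (M + 1)) k →ₐ[k] A := Ideal.Quotient.mkₐ k (chartIdeal X i)
  have hπs : Function.Surjective π := Ideal.Quotient.mkₐ_surjective _ _
  have hπ0 : ∀ P, π P = 0 ↔ P ∈ chartIdeal X i := fun P => Ideal.Quotient.eq_zero_iff_mem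
  have hG : π (F j * g) ≠ 0 := mt (hπ0 _).1 hGI
  let R := Localization.Away (π (F j * g))
  let ρ : MvPolynomial (Fin (M + 1)) k →ₐ[k] R := (IsScalarTower.toAlgHom k A R).comp π
  let ι : R := ρ g * IsLocalization.Away.invSelf (π (F j * g))
  have hι : ρ (F j) * ι = 1 := by
    have := IsLocalization.Away.mul_invSelf (S := R) (π (F j * g))
    rw [← mul_assoc, ← map_mul]
    exact this
  have hxρ : ∀ (x : R →ₐ[k] k) P, x (ρ P) = eval (fun l => x (ρ (MvPolynomial.X l))) P := fun x P => by
    rw [← aeval_eq_eval]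
    exact AlgHom.congr_fun (algHom_ext (f := x.comp ρ) (g := aeval fun l => x (ρ (MvPolynomial.X l)))
      fun l => by simp) P
  have hρI : ∀ P ∈ chartIdeal X i, ρ P = 0 := fun P hP => by
    change algebraMap A R (π P) = 0
    rw [(hπ0 P).2 hP, map_zero]
  have hρi : ρ (MvPolynomial.X i) = 1 := by
    rw [← sub_eq_zero, ← map_one ρ, ← map_sub]
    exact hρI _ (sub_one_mem_chartIdeal X i)
  have hpt : ∀ x : R →ₐ[k] k, (fun l => x (ρ (MvPolynomial.X l))) ∈ affChart X i := fun x => by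
    rw [hX.1.affChart_eq_zeroLocus]
    intro P hP
    rw [aeval_eq_eval, ← hxρ, hρI P hP, map_zero]
  have hGx : ∀ x : R →ₐ[k] k, x (ρ (F j * g)) ≠ 0 := fun x => by
    have : IsUnit (ρ (F j * g)) := IsLocalization.Away.algebraMap_isUnit (S := R) (π (F j * g))
    exact (this.map x).ne_zero
  have hfF : ∀ (x : R →ₐ[k] k) l, x (ρ (F l) * ι) = x ι * eval (fun l => x (ρ (MvPolynomial.X l))) (F l) :=
    fun x l => by rw [← hxρ, map_mul, mul_comm]
  refine ⟨R, inferInstance, Localization.Away.isDomain hG, inferInstance,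
    Localization.Away.finiteType _, fun l => ρ (MvPolynomial.X l), fun l => ρ (F l) * ι,
    ⟨hρi, hι, fun x y hxy => ?_, fun x hv => (hpt x).2.2, fun x hv hmem => ?_, fun x hv hw => ?_,
      fun r hr => ?_⟩, Localization.Away.trdeg_eq hG⟩
  · refine Localization.Away.algHom_ext' fun a => ?_
    obtain ⟨P, rfl⟩ := hπs a
    change x (ρ P) = y (ρ P)
    rw [hxρ, hxρ, funext hxy]
  · refine hGx x ?_
    rw [hxρ, map_mul, (hS _ hv).1 hmem g hg, mul_zero]
  · have hFv : (fun l => eval (fun l => x (ρ (MvPolynomial.X l))) (F l)) ≠ 0 := fun h0 => hGx x (by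
      rw [hxρ, map_mul, congrFun h0 j, Pi.zero_apply, zero_mul])
    rw [hF.2.2 _ (hpt x).2.2 _ hv rfl hFv]
    refine ((Projectivization.mk_eq_mk_iff' k _ _ _ _).2 ⟨x ι, ?_⟩).symm
    funext l
    exact (hfF x l).symm
  · obtain ⟨⟨a, s, n, rfl⟩, ha⟩ := IsLocalization.surj (.powers (π (F j * g))) r
    simp only at ha
    obtain ⟨P, rfl⟩ := hπs a
    have hPI : P ∉ chartIdeal X i := by
      intro hPI
      have := Localization.Away.isDomain hG
      rw [(hπ0 P).2 hPI, map_zero] at ha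
      refine mul_ne_zero hr ?_ ha
      rw [map_ne_zero_iff _ (Localization.Away.algebraMap_injective hG)]
      exact pow_ne_zero n hG
    obtain ⟨P', d, hP', hPP', -⟩ := P.exists_isHomogeneous_dehomogenize i
    have hXI : (MvPolynomial.X i : MvPolynomial (Fin (M + 1)) k) ∉ chartIdeal X i := fun h => by
      obtain ⟨v, hv⟩ := hi
      have := mem_chartIdeal.1 h v hv
      rw [eval_X, hv.1] at this
      exact one_ne_zero this
    have hP'I : P' ∉ chartIdeal X i := fun h => hPI (mem_chartIdeal.2 fun v hv => by
      rw [← hPP' v hv.1]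
      exact mem_chartIdeal.1 h v hv)
    have hQ := ((isHomogeneous_X k i).mul hP').mul ((hdF j).mul hdg)
    refine ⟨_, isAlgSet_setOf_vanishes hQ, fun hsub => ?_, fun p hp hpQ => ?_⟩
    · have : MvPolynomial.X i * P' * (F j * g) ∈ chartIdeal X i := mem_chartIdeal.2 fun v hv =>
        (vanishes_mk_iff hQ hv.2.1).1 (hsub hv.2.2)
      rcases hprime.mem_or_mem this with h | h
      · exact (hprime.mem_or_mem h).elim hXI hP'I
      · exact hGI h
    · induction p using Projectivization.ind with | h v hv =>
      have hvQ := mt (vanishes_mk_iff hQ hv).2 hpQ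
      simp only [map_mul, eval_X] at hvQ
      have hvi := left_ne_zero_of_mul (left_ne_zero_of_mul hvQ)
      obtain ⟨w, hw, hwv⟩ := exists_mk_eq_of_apply_ne_zero hv hvi
      rw [← hwv] at hp hpQ ⊢
      have hwQ := mt (vanishes_mk_iff hQ (ne_zero_of_apply_eq_one hw)).2 hpQ
      rw [map_mul, map_mul, hPP' w hw] at hwQ
      have hwI : ∀ a ∈ chartIdeal X i, aeval (R := k) w a = 0 := fun a ha => by
        rw [aeval_eq_eval]
        exact mem_chartIdeal.1 ha w ((mem_affChart hw).2 hp)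
      let χ : A →ₐ[k] k := Ideal.Quotient.liftₐ (chartIdeal X i) (aeval w) hwI
      have hχ : ∀ P, χ (π P) = eval w P := fun P => by
        rw [← aeval_eq_eval]
        exact Ideal.Quotient.liftₐ_apply _ _ _ _
      obtain ⟨x, hx⟩ := Localization.Away.exists_algHom χ (h := π (F j * g)) (by
        rw [hχ]
        exact right_ne_zero_of_mul hwQ)
      have hxw : ∀ P, x (ρ P) = eval w P := fun P => (hx _).trans (hχ P)
      refine ⟨x, fun h0 => right_ne_zero_of_mul (left_ne_zero_of_mul hwQ) ?_, fun hv' => ?_⟩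
      · rw [← hxw P]
        change x (algebraMap A R (π P)) = 0
        rw [← ha, map_mul, h0, zero_mul]
      · congr 1
        funext l
        rw [hxw, eval_X]

end PinchPaper

namespace PinchPaper

variable {k : Type} [Field k] {M N : ℕ}

section

variable {X : Set (Pr k M)} {φ : Pr k M → Pr k N} {Z : Set (Pr k M)}
    {i : Fin (M + 1)} {j : Fin (N + 1)} {R : Type} [CommRing R] [Algebra k R]
    {ξ : Fin (M + 1) → R} {f : Fin (N + 1) → R}

theorem IsAffModel.source_ne_zero (H : IsAffModel X φ Z i j ξ f) (x : R →ₐ[k] k) :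
    (fun l => x (ξ l)) ≠ 0 :=
  ne_zero_of_apply_eq_one (i := i) (by simp [H.source_one])

theorem IsAffModel.target_ne_zero (H : IsAffModel X φ Z i j ξ f) (x : R →ₐ[k] k) :
    (fun l => x (f l)) ≠ 0 :=
  ne_zero_of_apply_eq_one (i := j) (by simp [H.target_one])

theorem IsAffModel.target_mem_affChart (H : IsAffModel X φ Z i j ξ f) (x : R →ₐ[k] k) :
    (fun l => x (f l)) ∈ affChart (φ '' X) j :=
  ⟨by simp [H.target_one], H.target_ne_zero x, _, H.mem x (H.source_ne_zero x), H.map x _ _⟩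

theorem algHom_aeval_eq_eval {ι : Type*} (x : R →ₐ[k] k) (f : ι → R) (P : MvPolynomial ι k) :
    x (aeval f P) = eval (fun l => x (f l)) P := by
  rw [← aeval_eq_eval]
  exact AlgHom.congr_fun (algHom_ext (f := x.comp (aeval f)) (g := aeval fun l => x (f l))
    fun l => by simp) P

/-- A polynomial relation which holds identically on an affine model holds on all of `X`. -/
theorem IsAffModel.vanishes_of_aeval_eq_zero [Infinite k] (H : IsAffModel X φ Z i j ξ f)
    (hX : IsVariety X) (hφ : IsMorphismOn X φ) [Nontrivial R] {P : MvPolynomial (Fin (N + 1)) k}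
    {d : ℕ} (hP : P.IsHomogeneous d) (h0 : aeval f P = 0) {p : Pr k N} (hp : p ∈ φ '' X) :
    Vanishes P p := by
  obtain ⟨Z', hZ', hXZ', hdense⟩ := H.dense 1 one_ne_zero
  have hW := isAlgSet_preimage hX.1 hφ (isAlgSet_setOf_vanishes hP)
  obtain ⟨q, hq, rfl⟩ := hp
  refine (((hX.2.2 _ _ hZ' hW fun q hq => ?_).resolve_left hXZ') hq).2
  by_cases hqZ : q ∈ Z'
  · exact .inl hqZ
  obtain ⟨x, -, hx⟩ := hdense q hq hqZ
  refine .inr ⟨hq, ?_⟩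
  rw [← hx (H.source_ne_zero x), H.map x _ (H.target_ne_zero x)]
  exact (vanishes_mk_iff hP _).2 (by rw [← algHom_aeval_eq_eval, h0, map_zero])

theorem IsAffModel.aeval_eq_zero_iff [IsAlgClosed k] [IsDomain R] [Algebra.FiniteType k R]
    (H : IsAffModel X φ Z i j ξ f) (hX : IsVariety X) (hφ : IsMorphismOn X φ)
    (P : MvPolynomial (Fin (N + 1)) k) : aeval f P = 0 ↔ P ∈ chartIdeal (φ '' X) j := by
  refine ⟨fun h0 => mem_chartIdeal.2 fun v hv => ?_, fun hP => ?_⟩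
  · obtain ⟨P', d, hP', hPP', hspan⟩ := P.exists_isHomogeneous_dehomogenize j
    rw [← hPP' v hv.1]
    refine (vanishes_mk_iff hP' hv.2.1).1 (H.vanishes_of_aeval_eq_zero hX hφ hP' ?_ hv.2.2)
    obtain ⟨a, ha⟩ := Ideal.mem_span_singleton'.1 hspan
    rw [sub_eq_iff_eq_add.1 ha.symm]
    simp [h0, H.target_one]
  · by_contra h0
    obtain ⟨x, hx⟩ := exists_algHom_ne_zero (k := k) (b := aeval f P) fun h => h0 h.eq_zero
    rw [algHom_aeval_eq_eval] at hx
    exact hx (mem_chartIdeal.1 hP _ (H.target_mem_affChart x))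

theorem IsAffModel.algHom_ext_target (H : IsAffModel X φ Z i j ξ f) (hinj : InjOn φ (X \ Z))
    {x y : R →ₐ[k] k} (hxy : ∀ l, x (f l) = y (f l)) : x = y := by
  have hpt := hinj ⟨H.mem x (H.source_ne_zero x), H.notMem x _⟩
    ⟨H.mem y (H.source_ne_zero y), H.notMem y _⟩ (by
      rw [H.map x _ (H.target_ne_zero x), H.map y _ (H.target_ne_zero y)]
      simp only [hxy])
  obtain ⟨c, hc⟩ := (Projectivization.mk_eq_mk_iff' k _ _ _ _).1 hpt
  have h1 : c = 1 := by simpa [H.source_one] using congrFun hc i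
  exact (H.ext y x fun l => by simpa [h1] using congrFun hc l).symm

theorem IsAffModel.trdeg_eq_image [IsAlgClosed k] [IsDomain R] [Algebra.FiniteType k R]
    (H : IsAffModel X φ Z i j ξ f) (hX : IsVariety X) (hφ : IsMorphismOn X φ)
    (hinj : InjOn φ (X \ Z)) : Algebra.trdeg k R = Algebra.trdeg k (CoordRing (φ '' X) j) := by
  let g : CoordRing (φ '' X) j →ₐ[k] R := Ideal.Quotient.liftₐ (chartIdeal (φ '' X) j) (aeval f)
    fun P hP => (H.aeval_eq_zero_iff hX hφ P).2 hP
  have hgm (P) : g (Ideal.Quotient.mk _ P) = aeval f P := Ideal.Quotient.liftₐ_apply _ _ _ _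
  have hg : Function.Injective g := by
    rw [injective_iff_map_eq_zero]
    intro a ha
    obtain ⟨P, rfl⟩ := Ideal.Quotient.mk_surjective a
    exact Ideal.Quotient.eq_zero_iff_mem.2 ((H.aeval_eq_zero_iff hX hφ P).1 ((hgm P).symm.trans ha))
  have : Algebra.IsAlgebraic g.range R := isAlgebraic_of_separates_points _ fun x y hxy =>
    H.algHom_ext_target hinj fun l => hxy _ ⟨Ideal.Quotient.mk _ (MvPolynomial.X l), by simp [hgm]⟩
  rw [(AlgEquiv.ofInjective g hg).trdeg_eq]
  exact (Algebra.trdeg_eq_of_isAlgebraic Subtype.val_injective).symm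

end

theorem isMorphismOn_id (X : Set (Pr k M)) : IsMorphismOn X id := fun p _ => by
  have hX : ∀ v : Fin (M + 1) → k, (fun l => eval v (MvPolynomial.X l : MvPolynomial _ k)) = v :=
    fun v => funext fun l => eval_X l
  refine ⟨MvPolynomial.X, ⟨1, fun l => isHomogeneous_X k l⟩, ?_, fun q _ v hv hq hFv => ?_⟩
  · rw [hX]
    exact p.rep_nonzero
  · simp only [hX]
    exact hq.symm

theorem IsVariety.trdeg_coordRing_eq [IsAlgClosed k] {X : Set (Pr k M)} (hX : IsVariety X)
    {i j : Fin (M + 1)} (hi : (affChart X i).Nonempty) (hj : (affChart X j).Nonempty) :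
    Algebra.trdeg k (CoordRing X i) = Algebra.trdeg k (CoordRing X j) := by
  have : Infinite k := IsAlgClosed.instInfinite
  obtain ⟨R, _, _, _, _, ξ, f, H, hR⟩ := exists_isAffModel hX (isMorphismOn_id X) isAlgSet_empty
    (fun h => hX.2.1.not_subset_empty h) hi (j := j) (by rwa [image_id])
  rw [← hR, H.trdeg_eq_image hX (isMorphismOn_id X) (injOn_id _), image_id]

theorem IsVariety.hasDim_iff [IsAlgClosed k] {X : Set (Pr k M)} (hX : IsVariety X)
    {i : Fin (M + 1)} (hi : (affChart X i).Nonempty) {n : ℕ} :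
    HasDim X n ↔ Algebra.trdeg k (CoordRing X i) = n := by
  have key : ∀ j, (affChart X j).Nonempty → ∃ d : ℕ, ringKrullDim (CoordRing X j) = d ∧
      Algebra.trdeg k (CoordRing X j) = d := fun j hj => by
    have := hX.isPrime_chartIdeal hj
    have : IsDomain (CoordRing X j) := Ideal.Quotient.isDomain _
    exact exists_ringKrullDim_eq_trdeg_eq k _
  obtain ⟨d, hd, hd'⟩ := key i hi
  suffices Order.krullDim {W : Set (Pr k M) // IsVariety W ∧ W ⊆ X} = (d : WithBot ℕ∞) by
    rw [HasDim, this, hd']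
    norm_cast
  refine le_antisymm (iSup_le fun l => ?_) (hd ▸ hX.ringKrullDim_coordRing_le i)
  obtain ⟨j, hj, hl⟩ := hX.exists_length_le_ringKrullDim l
  obtain ⟨e, he, he'⟩ := key j hj
  have : e = d := by
    have := hX.trdeg_coordRing_eq hi hj
    rw [hd', he'] at this
    exact_mod_cast this.symm
  exact hl.trans_eq (this ▸ he)

end PinchPaper

open TensorProduct in
/-- If the functions `f` embed the points of an affine variety with functions `R`, then a general
point lies on no proper trisecant through a general second point: the linear projection from a
general point `z` separates general points. -/
theorem exists_forall_eq_of_projection_eq {k R : Type} {n N : ℕ} [Field k] [IsAlgClosed k]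
    [CharZero k] [CommRing R] [IsDomain R] [Algebra k R] [Algebra.FiniteType k R]
    (e : Basis (Fin n) R Ω[R⁄k]) (hn : n + 2 ≤ N) (f : Fin (N + 1) → R) (j₀ : Fin (N + 1))
    (hj₀ : f j₀ = 1) (hf : LinearIndependent k f)
    (hsep : ∀ x y : R →ₐ[k] k, (∀ l, x (f l) = y (f l)) → x = y) :
    ∃ a : R, a ≠ 0 ∧ ∀ z : R →ₐ[k] k, z a ≠ 0 → ∃ b : R, b ≠ 0 ∧ z b = 0 ∧
      ∀ x w : R →ₐ[k] k, x b ≠ 0 → w b ≠ 0 →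
        (∃ c s : k, ∀ l, w (f l) = c * x (f l) + s * z (f l)) → x = w := by
  obtain ⟨D, hD, hcol⟩ := exists_ne_zero_forall_collinear e hn f j₀ hj₀ hf hsep
  obtain ⟨a, ha, haD⟩ := TensorProduct.exists_algHom_map_ne_zero hD
  refine ⟨a, ha, fun z hz => ?_⟩
  obtain ⟨l₀, hl₀⟩ : ∃ l, l ≠ j₀ := by
    have : Nontrivial (Fin (N + 1)) := Fin.nontrivial_iff_two_le.2 (by omega)
    exact exists_ne j₀
  have hl₀z : f l₀ - algebraMap k R (z (f l₀)) ≠ 0 := fun h => by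
    refine one_ne_zero ((LinearIndepOn.pair_iff f hl₀).1 (hf.linearIndepOn _) 1 (-z (f l₀)) ?_).1
    rw [hj₀, one_smul, neg_smul, ← sub_eq_add_neg, ← Algebra.algebraMap_eq_smul_one, h]
  set ψ : R ⊗[k] R →ₐ[k] R := Algebra.TensorProduct.lift (AlgHom.id k R)
    ((Algebra.ofId k R).comp z) (fun _ _ => .all _ _) with hψ
  refine ⟨ψ D * (f l₀ - algebraMap k R (z (f l₀))), mul_ne_zero (haD z hz) hl₀z, by simp, ?_⟩
  rintro x w hx hw ⟨c, s, hcs⟩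
  rw [map_mul] at hx hw
  have hsum : c = 1 - s := by
    have := hcs j₀
    simp only [hj₀, map_one, mul_one] at this
    exact eq_sub_of_add_eq this.symm
  by_cases hs0 : s = 0
  · exact hsep _ _ fun l => by simp [hcs, hsum, hs0]
  by_cases hs1 : s = 1
  · refine absurd ?_ (right_ne_zero_of_mul hw)
    simp [hcs, hsum, hs1]
  refine absurd ?_ (left_ne_zero_of_mul hx)
  have hxψ : x.comp ψ = Algebra.TensorProduct.productMap x z := by
    refine Algebra.TensorProduct.ext' fun u v => ?_
    simp [hψ, Algebra.ofId_apply]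
  rw [← hcol x z w s hs0 hs1 fun l => hsum ▸ hcs l, ← hxψ, AlgHom.comp_apply]

namespace PinchPaper

theorem IsAffModel.linearIndependent {k : Type} [Field k] [Infinite k] {M N : ℕ}
    {X : Set (Pr k M)} {φ : Pr k M → Pr k N} {Z : Set (Pr k M)} {i : Fin (M + 1)} {j : Fin (N + 1)}
    {R : Type} [CommRing R] [Nontrivial R] [Algebra k R] {ξ : Fin (M + 1) → R}
    {f : Fin (N + 1) → R} (H : IsAffModel X φ Z i j ξ f) (hX : IsVariety X)
    (hφ : IsMorphismOn X φ) (hnd : Nondegenerate (φ '' X)) : LinearIndependent k f := by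
  refine Fintype.linearIndependent_iff.2 fun c hc l => ?_
  have hP : (∑ l, MvPolynomial.C (c l) * MvPolynomial.X l : MvPolynomial _ k).IsHomogeneous 1 :=
    .sum _ _ _ fun l _ => (isHomogeneous_X k l).C_mul _
  have h0 := hnd _ hP fun p hp => H.vanishes_of_aeval_eq_zero hX hφ hP
    (by simpa [Algebra.smul_def] using hc) hp
  simpa [Pi.single_apply] using congrArg (eval (Pi.single l 1)) h0

theorem hasDim_image {k : Type} [Field k] [IsAlgClosed k] {M N : ℕ} {X : Set (Pr k M)}
    {φ : Pr k M → Pr k N} (hX : IsVariety X) (hφ : IsMorphismOn X φ)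
    (hinj : GenericallyInjectiveOn X φ) {n : ℕ} (hn : HasDim X n) :
    IsVariety (φ '' X) ∧ HasDim (φ '' X) n := by
  have : Infinite k := IsAlgClosed.instInfinite
  obtain ⟨Z, hZ, hXZ, hinj⟩ := hinj
  have hY := hX.image_irreducible hφ (isAlgSet_image hX.1 hφ)
  obtain ⟨i, hi⟩ := exists_affChart_nonempty hX.2.1
  obtain ⟨j, hj⟩ := exists_affChart_nonempty hY.2.1
  obtain ⟨R, _, _, _, _, ξ, f, H, hR⟩ := exists_isAffModel hX hφ hZ hXZ hi hj
  rw [hX.hasDim_iff hi, ← hR, H.trdeg_eq_image hX hφ hinj] at hn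
  exact ⟨hY, (hY.hasDim_iff hj).2 hn⟩

/-- The points of a surface are, generically, separated by the projection from a general
point. -/
theorem forGeneralPointOn_projection_injOn {k : Type} [Field k] [IsAlgClosed k] [CharZero k]
    {M N n : ℕ} (hN : n + 2 ≤ N) {X : Set (Pr k M)} {φ : Pr k M → Pr k N} (hX : IsVariety X)
    (hdim : HasDim X n) (hφ : IsMorphismOn X φ) (hnd : Nondegenerate (φ '' X))
    (hinj : GenericallyInjectiveOn X φ) :
    ForGeneralPointOn X fun p => ∃ W, IsAlgSet W ∧ ¬ X ⊆ W ∧ p ∈ W ∧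
      ∀ (N' : ℕ) (L : (Fin (N + 1) → k) →ₗ[k] (Fin (N' + 1) → k)),
        LinearMap.ker L = Projectivization.submodule (φ p) → ∀ q ∈ X \ W, ∀ q' ∈ X \ W,
          ∃ (v v' : _) (hv : v ≠ 0) (hv' : v' ≠ 0) (hLv : L v ≠ 0) (hLv' : L v' ≠ 0),
            Projectivization.mk k v hv = φ q ∧ Projectivization.mk k v' hv' = φ q' ∧
            (Projectivization.mk k (L v) hLv = Projectivization.mk k (L v') hLv' → q = q') := by
  have : Infinite k := IsAlgClosed.instInfinite
  obtain ⟨Z, hZ, hXZ, hinj⟩ := hinj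
  obtain ⟨i, hi⟩ := exists_affChart_nonempty hX.2.1
  obtain ⟨j, hj⟩ := exists_affChart_nonempty (hX.2.1.image φ)
  obtain ⟨R₀, _, _, _, _, ξ₀, f₀, H₀, hR₀⟩ := exists_isAffModel hX hφ hZ hXZ hi hj
  obtain ⟨h, m, hh, ⟨e⟩⟩ := exists_basis_kaehlerDifferential_away k R₀
  let R := Localization.Away h
  have : IsDomain R := Localization.Away.isDomain hh
  have : Algebra.FiniteType k R := Localization.Away.finiteType h
  obtain ⟨ξ, f, H⟩ : ∃ (ξ : Fin (M + 1) → R) (f : Fin (N + 1) → R), IsAffModel X φ Z i j ξ f :=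
    ⟨_, _, H₀.localize hh⟩
  have hm : m ≤ n := by
    have hR := e.natCast_le_trdeg
    rw [Localization.Away.trdeg_eq hh, hR₀, (hX.hasDim_iff hi).1 hdim] at hR
    exact_mod_cast hR
  have hsep : ∀ x y : R →ₐ[k] k, (∀ l, x (f l) = y (f l)) → x = y :=
    fun x y => H.algHom_ext_target hinj
  obtain ⟨a, ha, hab⟩ := exists_forall_eq_of_projection_eq e (by omega) f j H.target_one
    (H.linearIndependent hX hφ hnd) hsep
  obtain ⟨Za, hZa, hXZa, hda⟩ := H.dense a ha
  refine ⟨Za, hZa, hXZa, fun p hp => ?_⟩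
  obtain ⟨z, hza, hzp⟩ := hda p hp.1 hp.2
  obtain ⟨b, hb, hzb, hbproj⟩ := hab z hza
  obtain ⟨W, hW, hXW, hdb⟩ := H.dense b hb
  have hpW : p ∈ W := by
    by_contra hpW
    obtain ⟨x, hxb, hxp⟩ := hdb p hp.1 hpW
    have hxz : x = z := hsep x z fun l => by
      have := (hxp (H.source_ne_zero x)).trans (hzp (H.source_ne_zero z)).symm
      obtain ⟨c, hc⟩ := (Projectivization.mk_eq_mk_iff' k _ _ _ _).1 this
      have h1 : c = 1 := by simpa [H.source_one] using congrFun hc i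
      rw [H.ext x z fun l => by simpa [h1] using (congrFun hc l).symm]
    exact hxb (hxz ▸ hzb)
  refine ⟨W, hW, hXW, hpW, fun N' L hL q hq q' hq' => ?_⟩
  obtain ⟨x, hxb, hxq⟩ := hdb q hq.1 hq.2
  obtain ⟨w, hwb, hwq⟩ := hdb q' hq'.1 hq'.2
  have hker : ∀ v, L v = 0 ↔ ∃ s : k, s • (fun l => z (f l)) = v := fun v => by
    rw [← LinearMap.mem_ker, hL, ← hzp (H.source_ne_zero z), H.map z _ (H.target_ne_zero z),
      Projectivization.submodule_mk, Submodule.mem_span_singleton]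
  have hLne : ∀ x : R →ₐ[k] k, x b ≠ 0 → L (fun l => x (f l)) ≠ 0 := fun x hx h0 => by
    obtain ⟨s, hs⟩ := (hker _).1 h0
    have h1 : s = 1 := by simpa [H.target_one] using congrFun hs j
    refine hx ?_
    rw [hsep x z fun l => by simpa [h1] using (congrFun hs l).symm, hzb]
  refine ⟨_, _, H.target_ne_zero x, H.target_ne_zero w, hLne x hxb, hLne w hwb, ?_, ?_, ?_⟩
  · rw [← hxq (H.source_ne_zero x), H.map]
  · rw [← hwq (H.source_ne_zero w), H.map]
  · intro hLL
    obtain ⟨c, hc⟩ := (Projectivization.mk_eq_mk_iff' k _ _ _ _).1 hLL.symm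
    obtain ⟨s, hs⟩ := (hker ((fun l => w (f l)) - c • fun l => x (f l))).1 (by
      rw [map_sub, map_smul, hc, sub_self])
    have hxw : x = w := hbproj x w hxb hwb ⟨c, s, fun l => by
      have := congrFun hs l
      simp only [Pi.smul_apply, Pi.sub_apply, smul_eq_mul] at this
      rw [this]
      ring⟩
    rw [← hxq (H.source_ne_zero x), ← hwq (H.source_ne_zero w), hxw]

/-- **Lemma (birationality of inner projection).** The resolved inner projection from a
general point is birational onto its image; in particular the image is a surface. -/
theorem stmt_2
    (k : Type) [Field k] [IsAlgClosed k] [CharZero k]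
    (M N : ℕ) (hN : 4 ≤ N)
    (X : Set (Pr k M)) (φ : Pr k M → Pr k N)
    (hX : IsSmoothSurface X) (hφ : Uncrumpled X φ) :
    ForGeneralPointOn X (fun x =>
      ∀ (M' : ℕ) (Xt : Set (Pr k M')) (β : Pr k M' → Pr k M)
        (φt : Pr k M' → Pr k (N - 1)) (L : (Fin (N + 1) → k) →ₗ[k] (Fin (N - 1 + 1) → k)),
        IsSmoothSurface Xt → IsBlowupAt Xt X β x →
        ResolvesInnerProj X φ x Xt β φt L →
        (GenericallyInjectiveOn Xt φt ∧ IsVariety (φt '' Xt) ∧ HasDim (φt '' Xt) 2)) := by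
  obtain ⟨Z, hZ, hXZ, hgen⟩ := forGeneralPointOn_projection_injOn hN hX.1 hX.2.1 hφ.1 hφ.2.1
    hφ.2.2.1
  refine ⟨Z, hZ, hXZ, fun x hx M' Xt β φt L hXt hβ hφt => ?_⟩
  have : Infinite k := IsAlgClosed.instInfinite
  obtain ⟨W, hW, hXW, hxW, hproj⟩ := hgen x hx
  obtain ⟨-, -, -, hβm, hβX, hβinj, -⟩ := hβ
  have hmem : ∀ {q}, q ∈ Xt \ {q | q ∈ Xt ∧ β q ∈ W} → β q ∈ X \ W := fun {q} hq =>
    ⟨hβX ▸ mem_image_of_mem β hq.1, fun h => hq.2 ⟨hq.1, h⟩⟩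
  have hne : ∀ {q}, β q ∈ X \ W → β q ≠ x := fun hq h => hq.2 (h ▸ hxW)
  have hinj : GenericallyInjectiveOn Xt φt := by
    refine ⟨_, isAlgSet_preimage hXt.1.1 hβm hW, fun hsub => hXW ?_, fun q hq q' hq' hqq' => ?_⟩
    · rw [← hβX]
      rintro _ ⟨q, hq, rfl⟩
      exact (hsub hq).2
    · obtain ⟨v, v', hv, hv', hLv, hLv', hvq, hvq', heq⟩ :=
        hproj _ L hφt.2.1 _ (hmem hq) _ (hmem hq')
      refine hβinj ⟨hq.1, hne (hmem hq)⟩ ⟨hq'.1, hne (hmem hq')⟩ (heq ?_)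
      rw [← hφt.2.2 q hq.1 (hne (hmem hq)) v hv hvq hLv, hqq',
        hφt.2.2 q' hq'.1 (hne (hmem hq')) v' hv' hvq' hLv']
  exact ⟨hinj, hasDim_image hXt.1 hφt.1 hinj hXt.2.1⟩

end PinchPaper
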